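/- arXiv:1508.04696 — 2 statements merged into one kernel-verified Lean document; each statement's English description precedes it below -/
import Mathlib

section
/- For all Q, R > 0, there is a constant C₀ = C₀(Q,R) > 0 with the following property. Suppose V is continuous and T-periodic with T ≥ 1 and ‖V‖_∞ ≤ Q, let D denote the discriminant and k the integrated density of states of H_V. If E₀ ∈ ℝ satisfies D(E₀) ∈ (-2,2) and |E₀| ≤ R, then (dk/dE)(E₀) ≥ (C₀/T) ∫₀^T ‖M_{E₀}(t)‖² dt, where for each t, M_{E₀}(t) ∈ SL(2,ℝ) is any matrix with M_{E₀}(t) Φ_{E₀}(t) M_{E₀}(t)^{-1} ∈ SO(2,ℝ) (the norm ‖M_{E₀}(t)‖ does not depend on the choice). -/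
open MeasureTheory Filter Set BoundedContinuousFunction
open scoped ENNReal

noncomputable section
/-- `A` is the transfer matrix `A_E^V(s,t)` of `-y'' + Vy = Ey`: it maps the Cauchy data
`(y'(t), y(t))ᵀ` of any solution to `(y'(s), y(s))ᵀ`, and has determinant one. -/
def IsTransferMatrix (V : ℝ → ℝ) (E : ℝ) (s t : ℝ) (A : Matrix (Fin 2) (Fin 2) ℝ) : Prop :=
  A.det = 1 ∧
    ∀ y : ℝ → ℝ, ContDiff ℝ 2 y →
      (∀ x : ℝ, -deriv (deriv y) x + V x * y x = E * y x) →
      A.mulVec ![deriv y t, y t] = ![deriv y s, y s]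
/-- The operator norm of a `2 × 2` real matrix, induced by the Euclidean norm on `ℝ²`. -/
def matOpNorm (A : Matrix (Fin 2) (Fin 2) ℝ) : ℝ :=
  ‖Matrix.toEuclideanCLM (𝕜 := ℝ) A‖

/-- Membership in `SO(2,ℝ)`. -/
def IsSO2 (A : Matrix (Fin 2) (Fin 2) ℝ) : Prop :=
  A * A.transpose = 1 ∧ A.det = 1
/-- The number of Dirichlet eigenvalues `≤ E` of `H_V` restricted to `[0, x]`: eigenvalues
are the energies `E'` whose solution with Cauchy data `u(0) = 0`, `u'(0) = 1` vanishes
at `x`. -/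
def dirichletCount (V : ℝ → ℝ) (x E : ℝ) : ℕ :=
  Set.ncard {E' : ℝ | E' ≤ E ∧ ∃ u : ℝ → ℝ, ContDiff ℝ 2 u ∧
    u 0 = 0 ∧ deriv u 0 = 1 ∧ u x = 0 ∧
    ∀ t : ℝ, -deriv (deriv u) t + V t * u t = E' * u t}

/-- `k` is the integrated density of states of `H_V`:
`k(E) = lim_{x → ∞} (1/x) · #{Dirichlet eigenvalues ≤ E of H_V on [0,x]}`. -/
def IsIDS (V : ℝ → ℝ) (k : ℝ → ℝ) : Prop :=
  ∀ E : ℝ, Tendsto (fun x : ℝ => (dirichletCount V x E : ℝ) / x) atTop (nhds (k E))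

lemma aux_sinsq_lip (a b : ℝ) : |Real.sin a ^ 2 - Real.sin b ^ 2| ≤ 2 * |a - b| := by
  have h : Real.sin a ^ 2 - Real.sin b ^ 2 = (Real.sin a - Real.sin b) * (Real.sin a + Real.sin b) := by ring
  rw [h, abs_mul]
  have h1 : |Real.sin a - Real.sin b| ≤ |a - b| := by
    have := Real.lipschitzWith_sin.dist_le_mul a b
    simpa [Real.dist_eq] using this
  have h2 : |Real.sin a + Real.sin b| ≤ 2 := by
    have := abs_add_le (Real.sin a) (Real.sin b)
    linarith [Real.abs_sin_le_one a, Real.abs_sin_le_one b]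
  nlinarith [abs_nonneg (Real.sin a - Real.sin b), abs_nonneg (Real.sin a + Real.sin b)]

lemma aux_vf_lip (f g : ℝ → ℝ) (G : ℝ) (hG : ∀ t, |g t| ≤ G) (t : ℝ) :
    LipschitzWith (Real.toNNReal (2 * G)) (fun θ => f t + g t * Real.sin θ ^ 2) := by
  have hG0 : 0 ≤ G := le_trans (abs_nonneg _) (hG 0)
  apply LipschitzWith.of_dist_le_mul
  intro a b
  rw [Real.coe_toNNReal _ (by linarith), Real.dist_eq, Real.dist_eq]
  have : f t + g t * Real.sin a ^ 2 - (f t + g t * Real.sin b ^ 2)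
      = g t * (Real.sin a ^ 2 - Real.sin b ^ 2) := by ring
  rw [this, abs_mul]
  calc |g t| * |Real.sin a ^ 2 - Real.sin b ^ 2| ≤ G * (2 * |a - b|) :=
        mul_le_mul (hG t) (aux_sinsq_lip a b) (abs_nonneg _) hG0
    _ = _ := by ring

lemma aux_prufer_exists (f g : ℝ → ℝ) (hf : Continuous f) (hg : Continuous g) (A G : ℝ)
    (hA : ∀ t, |f t| ≤ A) (hG : ∀ t, |g t| ≤ G) (θ₀ : ℝ) :
    ∃ θ : ℝ → ℝ, θ 0 = θ₀ ∧ ∀ t, HasDerivAt θ (f t + g t * Real.sin (θ t) ^ 2) t := by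
  have hG0 : 0 ≤ G := le_trans (abs_nonneg _) (hG 0)
  have hA0 : 0 ≤ A := le_trans (abs_nonneg _) (hA 0)
  have loc : ∀ N : ℕ, ∃ α : ℝ → ℝ, α 0 = θ₀ ∧ ∀ t ∈ Ioo (-(N:ℝ)) N,
      HasDerivAt α (f t + g t * Real.sin (α t) ^ 2) t := by
    intro N
    have hmem : (0:ℝ) ∈ Icc (-(N:ℝ)) N := by constructor <;> simp
    have hpl : IsPicardLindelof (fun t θ => f t + g t * Real.sin θ ^ 2)
        (⟨0, hmem⟩ : Icc (-(N:ℝ)) N) θ₀ (Real.toNNReal ((A+G) * N)) 0 (Real.toNNReal (A+G))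
        (Real.toNNReal (2 * G)) := by
      refine ⟨fun t _ => (aux_vf_lip f g G hG t).lipschitzOnWith, fun x _ => ?_, fun t _ x _ => ?_, ?_⟩
      · fun_prop
      · rw [Real.coe_toNNReal _ (by linarith), Real.norm_eq_abs]
        refine (abs_add_le _ _).trans (add_le_add (hA t) ?_)
        rw [abs_mul]
        have : |Real.sin x ^ 2| ≤ 1 := by
          rw [abs_pow]; exact pow_le_one₀ (abs_nonneg _) (Real.abs_sin_le_one x)
        nlinarith [hG t, abs_nonneg (g t), abs_nonneg (Real.sin x ^ 2)]
      · rw [Real.coe_toNNReal _ (by linarith), Real.coe_toNNReal _ (by positivity)]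
        simp
    obtain ⟨α, h0, h⟩ := hpl.exists_eq_forall_mem_Icc_hasDerivWithinAt₀
    exact ⟨α, h0, fun t ht => (h t (Ioo_subset_Icc_self ht)).hasDerivAt (Icc_mem_nhds ht.1 ht.2)⟩
  choose α h0 hd using loc
  have agree : ∀ M N : ℕ, ∀ t : ℝ, |t| < M → |t| < N → α M t = α N t := by
    have key : ∀ M N : ℕ, M ≤ N → ∀ t : ℝ, |t| < M → α M t = α N t := by
      intro M N hMN t ht
      have hMN' : (M:ℝ) ≤ N := by exact_mod_cast hMN
      have hMpos : (0:ℝ) < M := lt_of_le_of_lt (abs_nonneg t) ht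
      refine ODE_solution_unique_of_mem_Ioo (a := -(M:ℝ)) (b := M) (t₀ := 0) (s := fun _ => univ)
        (v := fun t θ => f t + g t * Real.sin θ ^ 2) (K := Real.toNNReal (2 * G))
        (fun t _ => (aux_vf_lip f g G hG t).lipschitzOnWith) ⟨by linarith, hMpos⟩
        (fun t ht => ⟨hd M t ht, trivial⟩) (fun t ht => ⟨hd N t ⟨by linarith [ht.1], by linarith [ht.2]⟩, trivial⟩)
        (by rw [h0, h0]) (abs_lt.mp ht)
    intro M N t hM hN
    rcases le_total M N with h | h
    · exact key M N h t hM
    · exact (key N M h t hN).symm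
  refine ⟨fun t => α (⌈|t|⌉₊ + 1) t, h0 _, fun t => ?_⟩
  have hlt : ∀ t : ℝ, |t| < ((⌈|t|⌉₊ + 1 : ℕ) : ℝ) := fun t => by
    push_cast; linarith [Nat.le_ceil |t|]
  have hev : (fun t => α (⌈|t|⌉₊ + 1) t) =ᶠ[nhds t] α (⌈|t|⌉₊ + 1) := by
    have : ∀ᶠ s in nhds t, |s| < ((⌈|t|⌉₊ + 1 : ℕ) : ℝ) :=
      continuous_abs.continuousAt.eventually (gt_mem_nhds (hlt t))
    filter_upwards [this] with s hs
    exact agree _ _ s (hlt s) hs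
  exact (hd _ t (abs_lt.mp (hlt t))).congr_of_eventuallyEq hev

/-- Prüfer solutions. -/
lemma aux_prufer_solution (p q r W g φ : ℝ → ℝ) (hp : ∀ t, 0 < p t)
    (hp' : ∀ t, HasDerivAt p (2 * r t) t) (hr' : ∀ t, HasDerivAt r (q t + W t * p t) t)
    (hdet : ∀ t, p t * q t - r t ^ 2 = 1) (hg : Continuous g)
    (hφ : ∀ t, HasDerivAt φ (1 / p t + g t * p t * Real.sin (φ t) ^ 2) t) :
    ∃ ρ : ℝ → ℝ, (∀ t, 0 < ρ t) ∧ ρ 0 = Real.sqrt (p 0) ∧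
      (∀ t, HasDerivAt (fun t => ρ t * Real.sqrt (p t) * Real.sin (φ t))
        (ρ t / Real.sqrt (p t) * (r t * Real.sin (φ t) + Real.cos (φ t))) t) ∧
      (∀ t, HasDerivAt (fun t => ρ t / Real.sqrt (p t) * (r t * Real.sin (φ t) + Real.cos (φ t)))
        ((W t - g t) * (ρ t * Real.sqrt (p t) * Real.sin (φ t))) t) := by
  have hpc : Continuous p := continuous_iff_continuousAt.2 fun t => (hp' t).continuousAt
  have hφc : Continuous φ := continuous_iff_continuousAt.2 fun t => (hφ t).continuousAt
  set a : ℝ → ℝ := fun t => - (g t * p t * Real.sin (φ t) * Real.cos (φ t)) with ha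
  have hac : Continuous a := by fun_prop
  have hI : ∀ t, HasDerivAt (fun t => ∫ s in (0:ℝ)..t, a s) (a t) t := fun t =>
    intervalIntegral.integral_hasDerivAt_right (hac.intervalIntegrable _ _)
      (hac.stronglyMeasurableAtFilter _ _) hac.continuousAt
  have hs : ∀ t, 0 < Real.sqrt (p t) := fun t => Real.sqrt_pos.2 (hp t)
  have hss : ∀ t, Real.sqrt (p t) ^ 2 = p t := fun t => Real.sq_sqrt (hp t).le
  have hsd : ∀ t, HasDerivAt (fun t => Real.sqrt (p t)) (r t / Real.sqrt (p t)) t := fun t => by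
    have := (hp' t).sqrt (hp t).ne'
    convert this using 1
    field_simp
  set ρ : ℝ → ℝ := fun t => Real.sqrt (p 0) * Real.exp (∫ s in (0:ℝ)..t, a s) with hρ
  have hρd : ∀ t, HasDerivAt ρ (ρ t * a t) t := fun t => by
    have := ((hI t).exp).const_mul (Real.sqrt (p 0))
    refine this.congr_deriv ?_
    simp only [hρ]; ring
  have hρpos : ∀ t, 0 < ρ t := fun t => mul_pos (hs 0) (Real.exp_pos _)
  refine ⟨ρ, hρpos, by simp [hρ], fun t => ?_, fun t => ?_⟩
  · have := ((hρd t).mul (hsd t)).mul (hφ t).sin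
    refine this.congr_deriv ?_
    have h2 := hss t
    have h3 := hs t
    have h4 := hp t
    simp only [ha, Pi.mul_apply]
    generalize Real.sqrt (p t) = s at *
    rw [← h2]
    field_simp
    ring
  · have := ((hρd t).div (hsd t) (hs t).ne').mul (((hr' t).mul (hφ t).sin).add (hφ t).cos)
    refine this.congr_deriv ?_
    have h2 := hss t
    have h3 := hs t
    have h4 := hp t
    have hd := hdet t
    have hq : q t = (1 + r t ^ 2) / p t := by
      field_simp; linarith
    have hc : Real.cos (φ t) ^ 2 = 1 - Real.sin (φ t) ^ 2 := by
      linarith [Real.sin_sq_add_cos_sq (φ t)]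
    simp only [ha, hq, Pi.mul_apply, Pi.add_apply, Pi.div_apply]
    generalize Real.sqrt (p t) = s at *
    rw [← h2]
    field_simp
    ring_nf
    simp only [hc]
    ring

/-- `y` with derivative `y1` solves `y'' = W y`. -/
def AuxSol (W y y1 : ℝ → ℝ) : Prop :=
  (∀ t, HasDerivAt y (y1 t) t) ∧ (∀ t, HasDerivAt y1 (W t * y t) t)

lemma aux_const {f : ℝ → ℝ} (h : ∀ t, HasDerivAt f 0 t) (x y : ℝ) : f x = f y :=
  is_const_of_deriv_eq_zero (fun t => (h t).differentiableAt) (fun t => (h t).deriv) x y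

lemma aux_wronskian {W y y1 z z1 : ℝ → ℝ} (hy : AuxSol W y y1) (hz : AuxSol W z z1) (t : ℝ) :
    y1 t * z t - y t * z1 t = y1 0 * z 0 - y 0 * z1 0 := by
  refine aux_const (f := fun t => y1 t * z t - y t * z1 t) (fun t => ?_) t 0
  refine (((hy.2 t).mul (hz.1 t)).sub ((hy.1 t).mul (hz.2 t))).congr_deriv ?_
  ring

lemma aux_fundamental (W : ℝ → ℝ) (hW : Continuous W) (K : ℝ) (hK : ∀ t, |W t| ≤ K) :
    ∃ s s1 c c1 : ℝ → ℝ, AuxSol W s s1 ∧ AuxSol W c c1 ∧ s 0 = 0 ∧ s1 0 = 1 ∧ c 0 = 1 ∧ c1 0 = 0 := by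
  have key : ∀ θ₀ : ℝ, ∃ y y1, AuxSol W y y1 ∧ y 0 = Real.sin θ₀ ∧ y1 0 = Real.cos θ₀ := by
    intro θ₀
    obtain ⟨θ, h0, hθ⟩ := aux_prufer_exists (fun _ => 1) (fun t => -1 - W t) (by fun_prop)
      (by fun_prop) 1 (1 + K) (by simp) (fun t => by
        have := abs_sub (-1) (W t)
        have h1 : |(-1:ℝ)| = 1 := by norm_num
        linarith [hK t]) θ₀
    obtain ⟨ρ, -, hρ0, h1, h2⟩ := aux_prufer_solution (fun _ => 1) (fun _ => 1) (fun _ => 0)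
      (fun _ => -1) (fun t => -1 - W t) θ (by simp)
      (fun t => (hasDerivAt_const t (1:ℝ)).congr_deriv (by norm_num))
      (fun t => (hasDerivAt_const t (0:ℝ)).congr_deriv (by norm_num)) (by norm_num) (by fun_prop)
      (fun t => (hθ t).congr_deriv (by norm_num))
    refine ⟨_, _, ⟨h1, fun t => (h2 t).congr_deriv ?_⟩, ?_, ?_⟩
    · ring
    · simp [hρ0, h0]
    · simp [hρ0, h0]
  obtain ⟨s, s1, hs, hs0, hs10⟩ := key 0
  obtain ⟨c, c1, hc, hc0, hc10⟩ := key (Real.pi / 2)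
  exact ⟨s, s1, c, c1, hs, hc, by simpa using hs0, by simpa using hs10, by simpa using hc0,
    by simpa using hc10⟩

lemma aux_unique {W s s1 c c1 : ℝ → ℝ} (hs : AuxSol W s s1) (hc : AuxSol W c c1)
    (s0 : s 0 = 0) (s10 : s1 0 = 1) (c0 : c 0 = 1) (c10 : c1 0 = 0)
    {y y1 : ℝ → ℝ} (hy : AuxSol W y y1) (t : ℝ) :
    y t = y1 0 * s t + y 0 * c t ∧ y1 t = y1 0 * s1 t + y 0 * c1 t := by
  have h1 := aux_wronskian hy hs t
  have h2 := aux_wronskian hy hc t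
  have h3 := aux_wronskian hs hc t
  rw [s0, s10] at h1
  rw [c0, c10] at h2
  rw [s0, s10, c0, c10] at h3
  constructor
  · linear_combination (-c t) * h1 + s t * h2 - y t * h3
  · linear_combination (-c1 t) * h1 + s1 t * h2 - y1 t * h3

lemma aux_sol_contDiff {V : ℝ → ℝ} (hV : Continuous V) {E : ℝ} {y y1 : ℝ → ℝ}
    (h : AuxSol (fun t => V t - E) y y1) :
    ContDiff ℝ 2 y ∧ deriv y = y1 ∧ ∀ x, -deriv (deriv y) x + V x * y x = E * y x := by
  have e1 : deriv y = y1 := funext fun t => (h.1 t).deriv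
  have e2 : deriv y1 = fun t => (V t - E) * y t := funext fun t => (h.2 t).deriv
  have hyd : Differentiable ℝ y := fun t => (h.1 t).differentiableAt
  have hy1d : Differentiable ℝ y1 := fun t => (h.2 t).differentiableAt
  refine ⟨?_, e1, fun x => ?_⟩
  · rw [show (2 : WithTop ℕ∞) = 1 + 1 by norm_num, contDiff_succ_iff_deriv]
    refine ⟨hyd, by simp, ?_⟩
    rw [e1, contDiff_one_iff_deriv, e2]
    exact ⟨hy1d, (hV.sub continuous_const).mul hyd.continuous⟩
  · rw [e1, e2]; ring

lemma aux_sol_of_contDiff {V : ℝ → ℝ} {E : ℝ} {y : ℝ → ℝ} (h2 : ContDiff ℝ 2 y)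
    (hy : ∀ x, -deriv (deriv y) x + V x * y x = E * y x) :
    AuxSol (fun t => V t - E) y (deriv y) := by
  rw [show (2 : WithTop ℕ∞) = 1 + 1 by norm_num, contDiff_succ_iff_deriv] at h2
  have h3 := h2.2.2
  rw [contDiff_one_iff_deriv] at h3
  exact ⟨fun t => (h2.1 t).hasDerivAt, fun t => (h3.1 t).hasDerivAt.congr_deriv (by linarith [hy t])⟩

lemma aux_inv (M P O : Matrix (Fin 2) (Fin 2) ℝ) (hM : M.det = 1) (hP : P.det = 1)
    (hO : O * O.transpose = 1) (h : M * P = O * M) :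
    0 < (M.transpose * M) 0 0 ∧
    (M.transpose * M) 0 0 * (M.transpose * M) 1 1 - (M.transpose * M) 0 1 ^ 2 = 1 ∧
    (P 0 0 - P 1 1) * (M.transpose * M) 0 0 = - 2 * P 1 0 * (M.transpose * M) 0 1 ∧
    P 0 1 * (M.transpose * M) 0 0 = - P 1 0 * (M.transpose * M) 1 1 := by
  have hO' : O.transpose * O = 1 := mul_eq_one_comm.mp hO
  have e : P.transpose * (M.transpose * M) * P = M.transpose * M := by
    calc P.transpose * (M.transpose * M) * P = (M * P).transpose * (M * P) := by
          rw [Matrix.transpose_mul]; simp only [Matrix.mul_assoc]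
      _ = M.transpose * (O.transpose * O) * M := by
          rw [h, Matrix.transpose_mul]; simp only [Matrix.mul_assoc]
      _ = _ := by rw [hO', Matrix.mul_one]
  have hsym : (M.transpose * M) 1 0 = (M.transpose * M) 0 1 := by
    simp [Matrix.mul_apply, Fin.sum_univ_two]; ring
  have hdet : (M.transpose * M) 0 0 * (M.transpose * M) 1 1 - (M.transpose * M) 0 1 ^ 2 = 1 := by
    have : (M.transpose * M).det = 1 := by rw [Matrix.det_mul, Matrix.det_transpose, hM]; norm_num
    rw [Matrix.det_fin_two, hsym] at this
    linarith
  have hpos : 0 ≤ (M.transpose * M) 0 0 := by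
    simp [Matrix.mul_apply, Fin.sum_univ_two]; nlinarith [mul_self_nonneg (M 0 0), mul_self_nonneg (M 1 0)]
  generalize M.transpose * M = B at *
  rw [Matrix.det_fin_two] at hP
  have e00 := congrFun (congrFun e 0) 0
  have e01 := congrFun (congrFun e 0) 1
  have e11 := congrFun (congrFun e 1) 1
  simp [Matrix.mul_apply, Fin.sum_univ_two, hsym] at e00 e01 e11
  refine ⟨lt_of_le_of_ne hpos ?_, hdet, ?_, ?_⟩
  · intro h0; rw [← h0] at hdet; nlinarith [sq_nonneg (B 0 1)]
  · linear_combination P 1 1 * e00 - P 1 0 * e01 - (P 0 0 * B 0 0 + P 1 0 * B 0 1) * hP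
  · linear_combination P 1 1 * e01 - P 1 0 * e11 - (P 0 1 * B 0 0 + P 1 1 * B 0 1) * hP

lemma aux_inv_unique (P : Matrix (Fin 2) (Fin 2) ℝ) (hP : P.det = 1) (htr : P.trace ∈ Ioo (-2:ℝ) 2)
    {x y z x' y' z' : ℝ} (hx : 0 < x) (hx' : 0 < x') (hd : x * z - y ^ 2 = 1)
    (hd' : x' * z' - y' ^ 2 = 1) (h1 : (P 0 0 - P 1 1) * x = -2 * P 1 0 * y)
    (h2 : P 0 1 * x = - P 1 0 * z) (h1' : (P 0 0 - P 1 1) * x' = -2 * P 1 0 * y')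
    (h2' : P 0 1 * x' = - P 1 0 * z') : x = x' ∧ z = z' := by
  rw [Matrix.det_fin_two] at hP
  rw [Matrix.trace_fin_two] at htr
  generalize P 0 0 = a at *
  generalize P 0 1 = b at *
  generalize P 1 0 = c at *
  generalize P 1 1 = d at *
  have hc : c ≠ 0 := by
    rintro rfl
    have := htr.1
    have := htr.2
    nlinarith [sq_nonneg (a - d)]
  have k1 : x ^ 2 * (4 - (a + d) ^ 2) = 4 * c ^ 2 := by
    have hz : c * z = - (b * x) := by linarith
    have hy : 2 * c * y = - ((a - d) * x) := by linarith
    have : 4 * (c * x * (c * z)) - (2 * c * y) ^ 2 = 4 * c ^ 2 := by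
      linear_combination 4 * c ^ 2 * hd
    rw [hz, hy] at this
    linear_combination this - 4 * x ^ 2 * hP
  have k1' : x' ^ 2 * (4 - (a + d) ^ 2) = 4 * c ^ 2 := by
    have hz : c * z' = - (b * x') := by linarith
    have hy : 2 * c * y' = - ((a - d) * x') := by linarith
    have : 4 * (c * x' * (c * z')) - (2 * c * y') ^ 2 = 4 * c ^ 2 := by
      linear_combination 4 * c ^ 2 * hd'
    rw [hz, hy] at this
    linear_combination this - 4 * x' ^ 2 * hP
  have hpos : 0 < 4 - (a + d) ^ 2 := by nlinarith [htr.1, htr.2]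
  have hxx : x = x' := by
    have : x ^ 2 = x' ^ 2 := mul_right_cancel₀ hpos.ne' (k1.trans k1'.symm)
    exact (pow_left_inj₀ hx.le hx'.le two_ne_zero).mp this
  refine ⟨hxx, ?_⟩
  subst hxx
  have : c * z = c * z' := by linarith
  exact mul_left_cancel₀ hc this

lemma aux_opnorm (A : Matrix (Fin 2) (Fin 2) ℝ) :
    matOpNorm A ^ 2 ≤ (A.transpose * A) 0 0 + (A.transpose * A) 1 1 := by
  have e : (A.transpose * A) 0 0 + (A.transpose * A) 1 1
      = A 0 0 ^ 2 + A 1 0 ^ 2 + A 0 1 ^ 2 + A 1 1 ^ 2 := by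
    simp [Matrix.mul_apply, Fin.sum_univ_two]; ring
  rw [e]
  set F := A 0 0 ^ 2 + A 1 0 ^ 2 + A 0 1 ^ 2 + A 1 1 ^ 2 with hF
  have hF0 : 0 ≤ F := by positivity
  have : matOpNorm A ≤ Real.sqrt F := by
    refine ContinuousLinearMap.opNorm_le_bound _ (Real.sqrt_nonneg _) fun v => ?_
    rw [EuclideanSpace.norm_eq, EuclideanSpace.norm_eq, ← Real.sqrt_mul hF0]
    apply Real.sqrt_le_sqrt
    simp [Fin.sum_univ_two, Matrix.mulVec, dotProduct]
    nlinarith [sq_nonneg (A 0 0 * v 1 - A 0 1 * v 0), sq_nonneg (A 1 0 * v 1 - A 1 1 * v 0)]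
  calc matOpNorm A ^ 2 ≤ Real.sqrt F ^ 2 := by
        apply pow_le_pow_left₀ (norm_nonneg _) this
    _ = F := Real.sq_sqrt hF0

lemma aux_floquet (V : ℝ → ℝ) (T : ℝ) (hV : Continuous V) (hper : Function.Periodic V T) (Q : ℝ)
    (hQ : ∀ x, |V x| ≤ Q) (E₀ : ℝ) (Φ : ℝ → Matrix (Fin 2) (Fin 2) ℝ)
    (hΦ : ∀ t : ℝ, IsTransferMatrix V E₀ (t + T) t (Φ t))
    (htr : (Φ 0).trace ∈ Set.Ioo (-2 : ℝ) 2) (M : ℝ → Matrix (Fin 2) (Fin 2) ℝ)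
    (hM : ∀ t : ℝ, (M t).det = 1 ∧ IsSO2 (M t * Φ t * (M t)⁻¹)) :
    ∃ p q r : ℝ → ℝ, (∀ t, 0 < p t) ∧ (∀ t, HasDerivAt p (2 * r t) t) ∧
      (∀ t, HasDerivAt r (q t + (V t - E₀) * p t) t) ∧ (∀ t, p t * q t - r t ^ 2 = 1) ∧
      Function.Periodic p T ∧ Function.Periodic r T ∧ Continuous q ∧
      ∀ t, matOpNorm (M t) ^ 2 ≤ p t + q t := by
  obtain ⟨s, s1, c, c1, hs, hc, s0, s10, c0, c10⟩ := aux_fundamental (fun t => V t - E₀)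
    (by fun_prop) (Q + |E₀|) (fun t => (abs_sub _ _).trans (by linarith [hQ t]))
  have hw : ∀ t, s1 t * c t - s t * c1 t = 1 := fun t => by
    have := aux_wronskian hs hc t
    rw [s0, s10, c0, c10] at this; linarith
  have shift : ∀ {y y1}, AuxSol (fun t => V t - E₀) y y1 →
      AuxSol (fun t => V t - E₀) (fun t => y (t + T)) (fun t => y1 (t + T)) := by
    intro y y1 h
    refine ⟨fun t => (h.1 (t + T)).comp_add_const t T, fun t => ?_⟩
    have := (h.2 (t + T)).comp_add_const t T
    refine this.congr_deriv ?_
    simp only [hper t]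
  have hsT := aux_unique hs hc s0 s10 c0 c10 (shift hs)
  have hcT := aux_unique hs hc s0 s10 c0 c10 (shift hc)
  simp only [zero_add] at hsT hcT
  obtain ⟨hs2, hsd, hse⟩ := aux_sol_contDiff hV hs
  obtain ⟨hc2, hcd, hce⟩ := aux_sol_contDiff hV hc
  have hΦs : ∀ t, (Φ t).mulVec ![s1 t, s t] = ![s1 (t+T), s (t+T)] := fun t => by
    have := (hΦ t).2 s hs2 hse; rwa [hsd] at this
  have hΦc : ∀ t, (Φ t).mulVec ![c1 t, c t] = ![c1 (t+T), c (t+T)] := fun t => by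
    have := (hΦ t).2 c hc2 hce; rwa [hcd] at this
  set S : ℝ → Matrix (Fin 2) (Fin 2) ℝ := fun t => !![s1 t, c1 t; s t, c t] with hS
  set Si : ℝ → Matrix (Fin 2) (Fin 2) ℝ := fun t => !![c t, -c1 t; -s t, s1 t] with hSi
  have hSS : ∀ t, S t * Si t = 1 := fun t => by
    have := hw t
    ext i j; fin_cases i <;> fin_cases j <;> simp [hS, hSi, Matrix.mul_apply, Fin.sum_univ_two] <;> linarith
  have hSS' : ∀ t, Si t * S t = 1 := fun t => mul_eq_one_comm.mp (hSS t)
  have hΦS : ∀ t, Φ t * S t = S (t + T) := fun t => by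
    have h0 := congrFun (hΦs t) 0
    have h1 := congrFun (hΦs t) 1
    have h2 := congrFun (hΦc t) 0
    have h3 := congrFun (hΦc t) 1
    simp [Matrix.mulVec, dotProduct, Fin.sum_univ_two] at h0 h1 h2 h3
    ext i j; fin_cases i <;> fin_cases j <;> simp [Matrix.mul_apply, Fin.sum_univ_two, *]
  have hΦ0 : Φ 0 = S T := by
    have := hΦS 0
    have h1 : S 0 = 1 := by
      ext i j; fin_cases i <;> fin_cases j <;> simp [hS, s0, s10, c0, c10]
    rwa [h1, Matrix.mul_one, zero_add] at this
  have hSΦ : ∀ t, S t * Φ 0 = S (t + T) := fun t => by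
    rw [hΦ0]
    ext i j; fin_cases i <;> fin_cases j <;> simp [hS, Matrix.mul_apply, Fin.sum_univ_two]
    · rw [(hsT t).2]; ring
    · rw [(hcT t).2]; ring
    · rw [(hsT t).1]; ring
    · rw [(hcT t).1]; ring
  set O := M 0 * Φ 0 * (M 0)⁻¹ with hOdef
  have hinv : ∀ t, (M t)⁻¹ * M t = 1 := fun t =>
    Matrix.nonsing_inv_mul _ (by rw [(hM t).1]; exact isUnit_one)
  have hMO : M 0 * Φ 0 = O * M 0 := by
    rw [hOdef, Matrix.mul_assoc, hinv, Matrix.mul_one]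
  have hO := (hM 0).2.1
  rw [← hOdef] at hO
  set N : ℝ → Matrix (Fin 2) (Fin 2) ℝ := fun t => M 0 * Si t with hN
  have hNdet : ∀ t, (N t).det = 1 := fun t => by
    simp only [hN, Matrix.det_mul, (hM 0).1, one_mul]
    simp only [hSi, Matrix.det_fin_two_of]
    linarith [hw t]
  have hSiΦ : ∀ t, Si t * Φ t = Φ 0 * Si t := fun t => by
    have : S t * Φ 0 = Φ t * S t := by rw [hSΦ, hΦS]
    calc Si t * Φ t = Si t * (Φ t * S t) * Si t := by
          rw [Matrix.mul_assoc, Matrix.mul_assoc, hSS, Matrix.mul_one]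
      _ = (Si t * S t) * Φ 0 * Si t := by rw [← this]; simp only [Matrix.mul_assoc]
      _ = _ := by rw [hSS', Matrix.one_mul]
  have hNΦ : ∀ t, N t * Φ t = O * N t := fun t => by
    simp only [hN]
    rw [Matrix.mul_assoc, hSiΦ, ← Matrix.mul_assoc, hMO, Matrix.mul_assoc]
  have hNper : ∀ t, N t = O * N (t + T) := fun t => by
    simp only [hN]
    rw [← Matrix.mul_assoc, ← hMO, Matrix.mul_assoc]
    congr 1
    calc Si t = Si t * (S (t+T) * Si (t+T)) := by rw [hSS, Matrix.mul_one]
      _ = (Si t * S t) * (Φ 0 * Si (t+T)) := by rw [← hSΦ]; simp only [Matrix.mul_assoc]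
      _ = _ := by rw [hSS', Matrix.one_mul]
  have hBper : ∀ t, (N (t+T)).transpose * N (t+T) = (N t).transpose * N t := fun t => by
    have hO' : O.transpose * O = 1 := mul_eq_one_comm.mp hO
    rw [hNper t, Matrix.transpose_mul O, Matrix.mul_assoc (N (t+T)).transpose, ← Matrix.mul_assoc O.transpose,
      hO', Matrix.one_mul]
  have hI := fun t => aux_inv (N t) (Φ t) O (hNdet t) (hΦ t).1 hO (hNΦ t)
  obtain ⟨b1, hb1⟩ : ∃ b, b = (M 0 0 0)^2 + (M 0 1 0)^2 := ⟨_, rfl⟩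
  obtain ⟨b2, hb2⟩ : ∃ b, b = M 0 0 0 * M 0 0 1 + M 0 1 0 * M 0 1 1 := ⟨_, rfl⟩
  obtain ⟨b3, hb3⟩ : ∃ b, b = (M 0 0 1)^2 + (M 0 1 1)^2 := ⟨_, rfl⟩
  set p : ℝ → ℝ := fun t => b1 * (c t * c t) - 2 * b2 * (c t * s t) + b3 * (s t * s t) with hp
  set r : ℝ → ℝ := fun t => b1 * (c t * c1 t) - b2 * (c t * s1 t + c1 t * s t) + b3 * (s t * s1 t) with hr
  set q : ℝ → ℝ := fun t => b1 * (c1 t * c1 t) - 2 * b2 * (c1 t * s1 t) + b3 * (s1 t * s1 t) with hq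
  have ep : ∀ t, ((N t).transpose * N t) 0 0 = p t := fun t => by
    simp [hN, hSi, hp, Matrix.mul_apply, Fin.sum_univ_two, hb1, hb2, hb3]; ring
  have er : ∀ t, ((N t).transpose * N t) 0 1 = - r t := fun t => by
    simp [hN, hSi, hr, Matrix.mul_apply, Fin.sum_univ_two, hb1, hb2, hb3]; ring
  have eq : ∀ t, ((N t).transpose * N t) 1 1 = q t := fun t => by
    simp [hN, hSi, hq, Matrix.mul_apply, Fin.sum_univ_two, hb1, hb2, hb3]; ring
  simp only [ep, er, eq] at hI
  have hΦtr : ∀ t, (Φ t).trace = (Φ 0).trace := fun t => by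
    have : Φ t = S t * (Φ 0 * Si t) := by
      rw [← hSiΦ, ← Matrix.mul_assoc, hSS, Matrix.one_mul]
    rw [this, Matrix.trace_mul_comm, Matrix.mul_assoc, hSS', Matrix.mul_one]
  refine ⟨p, q, r, fun t => (hI t).1, fun t => ?_, fun t => ?_, fun t => ?_, fun t => ?_, fun t => ?_, ?_,
    fun t => ?_⟩
  · refine (((((hc.1 t).mul (hc.1 t)).const_mul b1).sub (((hc.1 t).mul (hs.1 t)).const_mul (2 * b2))).add
      (((hs.1 t).mul (hs.1 t)).const_mul b3)).congr_deriv ?_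
    simp only [hr]; ring
  · refine (((((hc.1 t).mul (hc.2 t)).const_mul b1).sub ((((hc.1 t).mul (hs.2 t)).add ((hc.2 t).mul (hs.1 t))).const_mul b2)).add
      (((hs.1 t).mul (hs.2 t)).const_mul b3)).congr_deriv ?_
    simp only [hp, hq]; ring
  · have := (hI t).2.1; linarith
  · rw [← ep, ← ep, hBper]
  · have := er t
    have h2 := er (t + T)
    rw [hBper] at h2; linarith
  · have h1 : Continuous s1 := continuous_iff_continuousAt.2 fun t => (hs.2 t).continuousAt
    have h2 : Continuous c1 := continuous_iff_continuousAt.2 fun t => (hc.2 t).continuousAt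
    fun_prop
  · have hMt : M t * Φ t = (M t * Φ t * (M t)⁻¹) * M t := by
      rw [Matrix.mul_assoc _ (M t)⁻¹, hinv, Matrix.mul_one]
    have hJ := aux_inv (M t) (Φ t) _ (hM t).1 (hΦ t).1 (hM t).2.1 hMt
    have := aux_inv_unique (Φ t) (hΦ t).1 (by rw [hΦtr]; exact htr) hJ.1 (hI t).1 hJ.2.1 (hI t).2.1
      hJ.2.2.1 hJ.2.2.2 (hI t).2.2.1 (hI t).2.2.2
    rw [← this.1, ← this.2]
    exact aux_opnorm _

lemma aux_mul_sinc (x : ℝ) : x * Real.sinc x = Real.sin x := by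
  by_cases h : x = 0
  · simp [h]
  · rw [Real.sinc_of_ne_zero h]; field_simp

lemma aux_sinsq_sub (a b : ℝ) :
    Real.sin b ^ 2 - Real.sin a ^ 2 = Real.sin (a + b) * Real.sin (b - a) := by
  rw [Real.sin_add, Real.sin_sub]
  have h1 := Real.sin_sq_add_cos_sq a
  have h2 := Real.sin_sq_add_cos_sq b
  linear_combination (-Real.sin b ^ 2) * h1 + Real.sin a ^ 2 * h2

lemma aux_integral_deriv {a : ℝ → ℝ} (ha : Continuous a) (t : ℝ) :
    HasDerivAt (fun t => ∫ s in (0:ℝ)..t, a s) (a t) t :=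
  intervalIntegral.integral_hasDerivAt_right (ha.intervalIntegrable _ _)
      (ha.stronglyMeasurableAtFilter _ _) ha.continuousAt

lemma aux_strict (p : ℝ → ℝ) (hp : ∀ t, 0 < p t) (hpc : Continuous p) (e1 e2 : ℝ) (he : e1 < e2)
    (φ1 φ2 : ℝ → ℝ) (h10 : φ1 0 = 0) (h20 : φ2 0 = 0)
    (h1 : ∀ t, HasDerivAt φ1 (1 / p t + e1 * p t * Real.sin (φ1 t) ^ 2) t)
    (h2 : ∀ t, HasDerivAt φ2 (1 / p t + e2 * p t * Real.sin (φ2 t) ^ 2) t) (x : ℝ) (hx : 0 < x) :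
    φ1 x < φ2 x := by
  have c1 : Continuous φ1 := continuous_iff_continuousAt.2 fun t => (h1 t).continuousAt
  have c2 : Continuous φ2 := continuous_iff_continuousAt.2 fun t => (h2 t).continuousAt
  have hsc := Real.continuous_sinc
  set a : ℝ → ℝ := fun t => e1 * p t * Real.sin (φ1 t + φ2 t) * Real.sinc (φ2 t - φ1 t) with ha
  have hac : Continuous a := by
    have : Continuous fun t => Real.sinc (φ2 t - φ1 t) := hsc.comp (c2.sub c1)
    fun_prop
  set A : ℝ → ℝ := fun t => ∫ s in (0:ℝ)..t, a s with hA
  have hAd : ∀ t, HasDerivAt A (a t) t := aux_integral_deriv hac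
  set w : ℝ → ℝ := fun t => (φ2 t - φ1 t) * Real.exp (-A t) with hw
  set w' : ℝ → ℝ := fun t => (e2 - e1) * p t * Real.sin (φ2 t) ^ 2 * Real.exp (-A t) with hw'
  have hwd : ∀ t, HasDerivAt w (w' t) t := fun t => by
    refine (((h2 t).sub (h1 t)).mul ((hAd t).neg.exp)).congr_deriv ?_
    have k1 := aux_sinsq_sub (φ1 t) (φ2 t)
    rw [← aux_mul_sinc (φ2 t - φ1 t)] at k1
    simp only [hw', ha, Pi.sub_apply, Pi.neg_apply]
    linear_combination e1 * p t * Real.exp (-A t) * k1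
  have hmono : Monotone w := monotone_of_hasDerivAt_nonneg hwd fun t => by
    have := hp t
    have : 0 < e2 - e1 := by linarith
    simp only [hw', Pi.zero_apply]; positivity
  have hw0 : w 0 = 0 := by simp [hw, h10, h20]
  by_contra hcon
  have hwx : w x ≤ 0 := mul_nonpos_of_nonpos_of_nonneg (by linarith) (Real.exp_pos _).le
  have hwz : ∀ t ∈ Ioo 0 x, w t = 0 := fun t ht =>
    le_antisymm ((hmono ht.2.le).trans hwx) (hw0 ▸ hmono ht.1.le)
  have hsz : ∀ t ∈ Ioo 0 x, Real.sin (φ2 t) = 0 := fun t ht => by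
    have hev : w =ᶠ[nhds t] fun _ => 0 := by
      filter_upwards [Ioo_mem_nhds ht.1 ht.2] with s hs using hwz s hs
    have := (hwd t).unique ((hasDerivAt_const t (0:ℝ)).congr_of_eventuallyEq hev)
    simp only [hw'] at this
    have h3 := (hp t).ne'
    have h4 : e2 - e1 ≠ 0 := by linarith
    simpa [h3, h4] using this
  have hm : x / 2 ∈ Ioo 0 x := ⟨by linarith, by linarith⟩
  have hev : (fun t => Real.sin (φ2 t)) =ᶠ[nhds (x/2)] fun _ => 0 := by
    filter_upwards [Ioo_mem_nhds hm.1 hm.2] with s hs using hsz s hs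
  have h5 := (h2 (x/2)).sin.unique ((hasDerivAt_const (x/2) (0:ℝ)).congr_of_eventuallyEq hev)
  have h6 := hsz _ hm
  have h7 := Real.sin_sq_add_cos_sq (φ2 (x/2))
  rw [h6] at h5 h7
  have h8 := hp (x/2)
  have h9 : Real.cos (φ2 (x/2)) = 0 := by
    have h10 : (1 / p (x/2)) ≠ 0 := by positivity
    simpa [h10, h8.ne'] using h5
  rw [h9] at h7
  norm_num at h7

lemma aux_nonneg (p : ℝ → ℝ) (hp : ∀ t, 0 < p t) (e : ℝ)
    (φ : ℝ → ℝ) (h0 : φ 0 = 0)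
    (h : ∀ t, HasDerivAt φ (1 / p t + e * p t * Real.sin (φ t) ^ 2) t) (x : ℝ) (hx : 0 ≤ x) :
    0 ≤ φ x := by
  refine image_le_of_deriv_right_lt_deriv_boundary (f := fun _ => 0) (f' := fun _ => 0) (a := 0) (b := x)
    continuousOn_const (fun t _ => hasDerivWithinAt_const _ _ _) (le_of_eq h0.symm) h ?_
    (right_mem_Icc.2 hx)
  intro t _ ht
  rw [← ht]
  have := hp t
  simp [this]

lemma aux_cont (p : ℝ → ℝ) (hp : ∀ t, 0 < p t) (B : ℝ) (hB : ∀ t, p t ≤ B)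
    (φ : ℝ → ℝ → ℝ) (h0 : ∀ e, φ e 0 = 0)
    (h : ∀ e t, HasDerivAt (φ e) (1 / p t + e * p t * Real.sin (φ e t) ^ 2) t) (x : ℝ) (hx : 0 ≤ x) :
    Continuous fun e => φ e x := by
  have hB0 : 0 ≤ B := (hp 0).le.trans (hB 0)
  have hc : ∀ e, Continuous (φ e) := fun e => continuous_iff_continuousAt.2 fun t => (h e t).continuousAt
  refine continuous_iff_continuousAt.2 fun e0 => ?_
  rw [ContinuousAt, tendsto_iff_dist_tendsto_zero]
  set K := Real.toNNReal (2 * (|e0| * B))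
  have bound : ∀ e, dist (φ e x) (φ e0 x) ≤ gronwallBound 0 K (|e - e0| * B + 0) x := fun e => by
    have := dist_le_of_approx_trajectories_ODE (K := K) (a := 0) (b := x) (δ := 0)
      (εf := |e - e0| * B) (εg := 0)
      (v := fun t θ => 1 / p t + (e0 * p t) * Real.sin θ ^ 2)
      (aux_vf_lip (fun t => 1 / p t) (fun t => e0 * p t) (|e0| * B) (fun t => by
        rw [abs_mul, abs_of_pos (hp t)]; exact mul_le_mul_of_nonneg_left (hB t) (abs_nonneg _)))
      (f := φ e) (g := φ e0) (hc e).continuousOn (fun t _ => (h e t).hasDerivWithinAt)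
      (fun t _ => by
        rw [Real.dist_eq]
        have : 1 / p t + e * p t * Real.sin (φ e t) ^ 2 - (1 / p t + e0 * p t * Real.sin (φ e t) ^ 2)
          = (e - e0) * (p t * Real.sin (φ e t) ^ 2) := by ring
        rw [this, abs_mul]
        refine mul_le_mul_of_nonneg_left ?_ (abs_nonneg _)
        have h1 := hp t
        rw [abs_of_nonneg (by positivity)]
        nlinarith [Real.sin_sq_le_one (φ e t), hB t])
      (hc e0).continuousOn (fun t _ => (h e0 t).hasDerivWithinAt) (fun t _ => by simp)
      (by simp [h0]) x (right_mem_Icc.2 hx)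
    simpa using this
  refine squeeze_zero (fun _ => dist_nonneg) bound ?_
  have hg : Continuous fun e => gronwallBound 0 K (|e - e0| * B + 0) x :=
    (gronwallBound_continuous_ε 0 K x).comp (by fun_prop)
  have := hg.tendsto e0
  simpa [gronwallBound_ε0_δ0] using this

lemma aux_count (F : ℝ → ℝ) (hF : StrictMono F) (hc : Continuous F) (h0 : ∀ e, 0 ≤ F e)
    (e0 e : ℝ) (he : e0 ≤ e) :
    (({e' : ℝ | e' ≤ e0 ∧ ∃ n : ℤ, F e' = n * Real.pi}.ncard : ℝ)) + ((F e - F e0) / Real.pi - 1)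
      ≤ ({e' : ℝ | e' ≤ e ∧ ∃ n : ℤ, F e' = n * Real.pi}.ncard : ℝ) := by
  have hpi := Real.pi_pos
  have fin : ∀ e, {e' : ℝ | e' ≤ e ∧ ∃ n : ℤ, F e' = n * Real.pi}.Finite := by
    intro e
    refine Set.Finite.of_injOn (f := F) (t := (fun n : ℤ => (n:ℝ) * Real.pi) '' (Icc 0 ⌊F e / Real.pi⌋)) ?_
      hF.injective.injOn ((Set.finite_Icc _ _).image _)
    rintro e' ⟨hle, n, hn⟩
    refine ⟨n, ⟨?_, ?_⟩, hn.symm⟩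
    · have := h0 e'
      rw [hn] at this
      have := nonneg_of_mul_nonneg_left this hpi
      exact_mod_cast this
    · rw [Int.le_floor, le_div_iff₀ hpi, ← hn]
      exact hF.monotone hle
  have ivt : ∀ n ∈ Finset.Ioc ⌊F e0 / Real.pi⌋ ⌊F e / Real.pi⌋, ∃ e', e' ∈ Ioc e0 e ∧ F e' = n * Real.pi := by
    intro n hn
    rw [Finset.mem_Ioc, Int.floor_lt, Int.le_floor, div_lt_iff₀ hpi, le_div_iff₀ hpi] at hn
    exact intermediate_value_Ioc he hc.continuousOn hn
  choose! z hz1 hz2 using ivt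
  set J := Finset.Ioc ⌊F e0 / Real.pi⌋ ⌊F e / Real.pi⌋ with hJ
  have hinj : Set.InjOn z (J : Set ℤ) := by
    intro a ha b hb hab
    have h1 := hz2 a ha
    rw [hab, hz2 b hb] at h1
    have := mul_right_cancel₀ hpi.ne' h1
    exact_mod_cast this.symm
  have hcard : (z '' (J : Set ℤ)).ncard = J.card := by
    rw [Set.InjOn.ncard_image hinj, Set.ncard_coe_finset]
  have hdisj : Disjoint {e' : ℝ | e' ≤ e0 ∧ ∃ n : ℤ, F e' = n * Real.pi} (z '' (J : Set ℤ)) := by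
    rw [Set.disjoint_left]
    rintro _ ⟨h1, -⟩ ⟨n, hn, rfl⟩
    exact absurd (hz1 n hn).1 (not_lt.2 h1)
  have hsub : {e' : ℝ | e' ≤ e0 ∧ ∃ n : ℤ, F e' = n * Real.pi} ∪ (z '' (J : Set ℤ)) ⊆
      {e' : ℝ | e' ≤ e ∧ ∃ n : ℤ, F e' = n * Real.pi} := by
    rintro e' (⟨h1, h2⟩ | ⟨n, hn, rfl⟩)
    · exact ⟨h1.trans he, h2⟩
    · exact ⟨(hz1 n hn).2, n, hz2 n hn⟩
  have h1 := Set.ncard_le_ncard hsub (fin e)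
  rw [Set.ncard_union_eq hdisj (fin e0) (J.finite_toSet.image z), hcard, hJ, Int.card_Ioc] at h1
  have h2 : ((⌊F e / Real.pi⌋ - ⌊F e0 / Real.pi⌋ : ℤ) : ℝ) ≤ (((⌊F e / Real.pi⌋ - ⌊F e0 / Real.pi⌋).toNat : ℕ) : ℝ) := by
    exact_mod_cast Int.self_le_toNat _
  have h3 : (({e' : ℝ | e' ≤ e0 ∧ ∃ n : ℤ, F e' = n * Real.pi}.ncard : ℝ)) + (((⌊F e / Real.pi⌋ - ⌊F e0 / Real.pi⌋).toNat : ℕ) : ℝ)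
      ≤ ({e' : ℝ | e' ≤ e ∧ ∃ n : ℤ, F e' = n * Real.pi}.ncard : ℝ) := by exact_mod_cast h1
  push_cast at h2
  have h4 := Int.floor_le (F e0 / Real.pi)
  have h5 := Int.lt_floor_add_one (F e / Real.pi)
  rw [sub_div]
  linarith

lemma aux_average (p : ℝ → ℝ) (hp : ∀ t, 0 < p t) (hpc : Continuous p) (T : ℝ) (hT : 0 < T)
    (hper : Function.Periodic p T) (α : ℝ → ℝ) (hα0 : α 0 = 0) (hα : ∀ t, HasDerivAt α (1 / p t) t)
    (hω : Real.sin (α T) ≠ 0) :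
    ∃ K : ℝ, 0 ≤ K ∧ ∀ e : ℝ, 0 ≤ e → ∀ φ : ℝ → ℝ, φ 0 = 0 →
      (∀ t, HasDerivAt φ (1 / p t + e * p t * Real.sin (φ t) ^ 2) t) →
      ∀ t, 0 ≤ t → α t + e * (1/2 - 2 * K * e) * (∫ s in (0:ℝ)..t, p s) - 2 * K * e ≤ φ t := by
  have hαc : Continuous α := continuous_iff_continuousAt.2 fun t => (hα t).continuousAt
  have hαT : ∀ t, α (t + T) = α t + α T := fun t => by
    have := aux_const (f := fun t => α (t + T) - α t) (fun t => by
      refine (((hα (t + T)).comp_add_const t T).sub (hα t)).congr_deriv ?_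
      rw [hper t]; ring) t 0
    simp only [zero_add, hα0] at this
    linarith
  set C := Real.cos (2 * α T) with hC
  set S := Real.sin (2 * α T) with hS
  have hCS : S ^ 2 + C ^ 2 = 1 := Real.sin_sq_add_cos_sq _
  have hC1 : 1 - C ≠ 0 := by
    rw [hC, Real.cos_two_mul, Real.cos_sq']
    intro h
    apply hω
    have : Real.sin (α T) ^ 2 = 0 := by linarith
    exact pow_eq_zero_iff two_ne_zero |>.1 this
  set a1 : ℝ → ℝ := fun t => - (1/2) * p t * Real.cos (2 * α t) with ha1
  set a2 : ℝ → ℝ := fun t => - (1/2) * p t * Real.sin (2 * α t) with ha2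
  have ha1c : Continuous a1 := by fun_prop
  have ha2c : Continuous a2 := by fun_prop
  set I1 := ∫ s in (0:ℝ)..T, a1 s with hI1
  set I2 := ∫ s in (0:ℝ)..T, a2 s with hI2
  obtain ⟨x0, y0, hx0, hy0⟩ : ∃ x0 y0 : ℝ, x0 + I1 = C * x0 - S * y0 ∧ y0 + I2 = S * x0 + C * y0 := by
    refine ⟨- ((1 - C) * I1 - S * I2) / (2 * (1 - C)), - (S * I1 + (1 - C) * I2) / (2 * (1 - C)), ?_, ?_⟩
    · field_simp
      linear_combination (-I1) * hCS
    · field_simp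
      linear_combination (-I2) * hCS
  set X : ℝ → ℝ := fun t => x0 + ∫ s in (0:ℝ)..t, a1 s with hX
  set Y : ℝ → ℝ := fun t => y0 + ∫ s in (0:ℝ)..t, a2 s with hY
  have hXd : ∀ t, HasDerivAt X (a1 t) t := fun t => (aux_integral_deriv ha1c t).const_add x0
  have hYd : ∀ t, HasDerivAt Y (a2 t) t := fun t => (aux_integral_deriv ha2c t).const_add y0
  have hXT : ∀ t, X (t + T) = C * X t - S * Y t := fun t => by
    have := aux_const (f := fun t => X (t + T) - (C * X t - S * Y t)) (fun t => by
      refine (((hXd (t + T)).comp_add_const t T).sub (((hXd t).const_mul C).sub ((hYd t).const_mul S))).congr_deriv ?_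
      simp only [ha1, ha2, hper t, hαT t, mul_add, Real.cos_add, ← hC, ← hS]; ring) t 0
    simp only [zero_add] at this
    have h0 : X T = x0 + I1 := rfl
    have h1 : X 0 = x0 := by simp [hX]
    have h2 : Y 0 = y0 := by simp [hY]
    rw [h0, h1, h2] at this
    linarith
  have hYT : ∀ t, Y (t + T) = S * X t + C * Y t := fun t => by
    have := aux_const (f := fun t => Y (t + T) - (S * X t + C * Y t)) (fun t => by
      refine (((hYd (t + T)).comp_add_const t T).sub (((hXd t).const_mul S).add ((hYd t).const_mul C))).congr_deriv ?_
      simp only [ha1, ha2, hper t, hαT t, mul_add, Real.sin_add, ← hC, ← hS]; ring) t 0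
    simp only [zero_add] at this
    have h0 : Y T = y0 + I2 := rfl
    have h1 : X 0 = x0 := by simp [hX]
    have h2 : Y 0 = y0 := by simp [hY]
    rw [h0, h1, h2] at this
    linarith
  have hXc : Continuous X := continuous_iff_continuousAt.2 fun t => (hXd t).continuousAt
  have hYc : Continuous Y := continuous_iff_continuousAt.2 fun t => (hYd t).continuousAt
  have hXYper : Function.Periodic (fun t => X t ^ 2 + Y t ^ 2) T := fun t => by
    simp only [hXT, hYT]
    linear_combination (X t ^ 2 + Y t ^ 2) * hCS
  obtain ⟨B, hB⟩ := (hXYper.compact_of_continuous hT.ne' (by fun_prop)).bddAbove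
  have hB' : ∀ t, X t ^ 2 + Y t ^ 2 ≤ B := fun t => hB ⟨t, rfl⟩
  have hB0 : 0 ≤ B := le_trans (by positivity) (hB' 0)
  have hb : ∀ t u v, |u| ≤ 1 → |v| ≤ 1 → |X t * u + Y t * v| ≤ 1 + B := fun t u v hu hv => by
    have h1 : |X t| ≤ (1 + X t ^ 2) / 2 := by
      rw [← sq_abs]; nlinarith [sq_nonneg (|X t| - 1)]
    have h2 : |Y t| ≤ (1 + Y t ^ 2) / 2 := by
      rw [← sq_abs]; nlinarith [sq_nonneg (|Y t| - 1)]
    have h3 : |X t * u| ≤ |X t| := by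
      rw [abs_mul]; exact mul_le_of_le_one_right (abs_nonneg _) hu
    have h4 : |Y t * v| ≤ |Y t| := by
      rw [abs_mul]; exact mul_le_of_le_one_right (abs_nonneg _) hv
    linarith [abs_add_le (X t * u) (Y t * v), hB' t]
  refine ⟨1 + B, by linarith, ?_⟩
  set K := 1 + B with hK
  intro e he φ hφ0 hφ t ht
  set β : ℝ → ℝ := fun t => φ t - α t with hβ
  have hβd : ∀ t, HasDerivAt β (e * p t * Real.sin (φ t) ^ 2) t := fun t =>
    ((hφ t).sub (hα t)).congr_deriv (by ring)
  set h : ℝ → ℝ := fun t => X t * Real.cos (2 * β t) - Y t * Real.sin (2 * β t) with hh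
  have hhd : ∀ t, HasDerivAt h (- (1/2) * p t * Real.cos (2 * φ t) +
      e * p t * Real.sin (φ t) ^ 2 * (2 * (- X t * Real.sin (2 * β t) - Y t * Real.cos (2 * β t)))) t := fun t => by
    have k := (hβd t).const_mul 2
    refine (((hXd t).mul k.cos).sub ((hYd t).mul k.sin)).congr_deriv ?_
    have : 2 * φ t = 2 * α t + 2 * β t := by simp only [hβ]; ring
    rw [this, Real.cos_add]
    simp only [ha1, ha2]
    ring
  set χ : ℝ → ℝ := fun t => φ t - e * h t - α t - e * (1/2 - 2 * K * e) * (∫ s in (0:ℝ)..t, p s) with hχ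
  have hχd := fun t => (((hφ t).sub ((hhd t).const_mul e)).sub (hα t)).sub
    ((aux_integral_deriv hpc t).const_mul (e * (1/2 - 2 * K * e)))
  have hmono : Monotone χ := by
    refine monotone_of_hasDerivAt_nonneg hχd fun t => ?_
    have k1 := hb t (Real.sin (2 * β t)) (Real.cos (2 * β t)) (Real.abs_sin_le_one _) (Real.abs_cos_le_one _)
    have k2 := (abs_le.1 k1).1
    have k3 := hp t
    have k4 := Real.sin_sq_le_one (φ t)
    have k5 := sq_nonneg (Real.sin (φ t))
    have k6 : 0 ≤ 2 * e ^ 2 * p t := by positivity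
    simp only [Pi.zero_apply]
    have : 1 / p t + e * p t * Real.sin (φ t) ^ 2 -
          e * (-(1 / 2) * p t * Real.cos (2 * φ t) +
              e * p t * Real.sin (φ t) ^ 2 * (2 * (-X t * Real.sin (2 * β t) - Y t * Real.cos (2 * β t)))) - 1 / p t -
        e * (1 / 2 - 2 * K * e) * p t = 2 * e ^ 2 * p t * (Real.sin (φ t) ^ 2 * (X t * Real.sin (2 * β t) + Y t * Real.cos (2 * β t)) + K) := by
      rw [Real.cos_two_mul, Real.cos_sq']; ring
    rw [this]
    apply mul_nonneg k6
    nlinarith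
  have hm := hmono ht
  have e0 : χ 0 = - e * h 0 := by simp [hχ, hφ0, hα0]
  rw [e0] at hm
  simp only [hχ] at hm
  have hhb : ∀ t, |h t| ≤ K := fun t => by
    have := hb t (Real.cos (2 * β t)) (-Real.sin (2 * β t)) (Real.abs_cos_le_one _) (by rw [abs_neg]; exact Real.abs_sin_le_one _)
    simp only [hh]
    rwa [mul_neg, ← sub_eq_add_neg] at this
  have h1 := (abs_le.1 (hhb t)).1
  have h2 := (abs_le.1 (hhb 0)).2
  nlinarith

/-- For all `Q, R > 0` there is `C₀ = C₀(Q,R) > 0` such that: if `V` is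
continuous and `T`-periodic with `T ≥ 1` and `‖V‖_∞ ≤ Q`, `k` is the integrated density of
states of `H_V`, `Φ t` is the monodromy matrix `A_{E₀}^V(t+T, t)`, the discriminant satisfies
`D(E₀) = tr Φ(0) ∈ (-2,2)` with `|E₀| ≤ R`, and for each `t` the matrix `M t ∈ SL(2,ℝ)`
conjugates `Φ t` into `SO(2,ℝ)`, then `k'(E₀) ≥ (C₀/T) ∫₀ᵀ ‖M t‖² dt`. -/
theorem ids_derivative_ge_transfer_conjugacy_bound (Q R : ℝ) (hQ : 0 < Q) (hR : 0 < R) :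
    ∃ C₀ : ℝ, 0 < C₀ ∧
      ∀ (V : ℝ → ℝ) (T : ℝ), Continuous V → Function.Periodic V T → 1 ≤ T →
        (∀ x : ℝ, |V x| ≤ Q) →
      ∀ E₀ : ℝ, |E₀| ≤ R →
      ∀ Φ : ℝ → Matrix (Fin 2) (Fin 2) ℝ, (∀ t : ℝ, IsTransferMatrix V E₀ (t + T) t (Φ t)) →
        (Φ 0).trace ∈ Set.Ioo (-2 : ℝ) 2 →
      ∀ M : ℝ → Matrix (Fin 2) (Fin 2) ℝ,
        (∀ t : ℝ, (M t).det = 1 ∧ IsSO2 (M t * Φ t * (M t)⁻¹)) →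
      ∀ k : ℝ → ℝ, IsIDS V k →
      ∀ k' : ℝ, HasDerivAt k k' E₀ →
        C₀ / T * ∫ t in (0 : ℝ)..T, matOpNorm (M t) ^ 2 ≤ k' := by
  have hpi := Real.pi_pos
  refine ⟨1 / (2 * Real.pi * (1 + Q + R)), by positivity, ?_⟩
  intro V T hV hper hT1 hVQ E₀ hE₀ Φ hΦ htr M hM k hk k' hk'
  have hT : 0 < T := by linarith
  obtain ⟨p, q, r, hp, hp', hr', hdet, pper, rper, hqc, hMpq⟩ :=
    aux_floquet V T hV hper Q hVQ E₀ Φ hΦ htr M hM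
  have hpc : Continuous p := continuous_iff_continuousAt.2 fun t => (hp' t).continuousAt
  obtain ⟨B, hB⟩ := (pper.compact_of_continuous hT.ne' hpc).bddAbove
  have hB' : ∀ t, p t ≤ B := fun t => hB ⟨t, rfl⟩
  have hipc : Continuous fun t => 1 / p t := continuous_const.div hpc fun t => (hp t).ne'
  have iper : Function.Periodic (fun t => 1 / p t) T := fun t => by simp only [pper t]
  obtain ⟨A, hA⟩ := (iper.compact_of_continuous hT.ne' hipc).bddAbove
  have hA' : ∀ t, |1 / p t| ≤ A := fun t => by
    rw [abs_of_pos (one_div_pos.2 (hp t))]; exact hA ⟨t, rfl⟩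
  have hex : ∀ e : ℝ, ∃ φ : ℝ → ℝ, φ 0 = 0 ∧
      ∀ t, HasDerivAt φ (1 / p t + e * p t * Real.sin (φ t) ^ 2) t := fun e =>
    aux_prufer_exists (fun t => 1 / p t) (fun t => e * p t) hipc (by fun_prop) A (|e| * B) hA'
      (fun t => by
        rw [abs_mul, abs_of_pos (hp t)]; exact mul_le_mul_of_nonneg_left (hB' t) (abs_nonneg _)) 0
  choose φ hφ0 hφ using hex
  -- solutions from the angle
  have hsol : ∀ e : ℝ, ∃ ρ y1 : ℝ → ℝ, (∀ t, 0 < ρ t) ∧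
      AuxSol (fun t => V t - (E₀ + e)) (fun t => ρ t * Real.sqrt (p t) * Real.sin (φ e t)) y1 ∧
      y1 0 = 1 := fun e => by
    obtain ⟨ρ, hρ, hρ0, h1, h2⟩ := aux_prufer_solution p q r (fun t => V t - E₀) (fun _ => e) (φ e)
      hp hp' hr' hdet continuous_const (hφ e)
    refine ⟨ρ, _, hρ, ⟨h1, fun t => (h2 t).congr_deriv ?_⟩, ?_⟩
    · ring
    · have := (Real.sqrt_pos.2 (hp 0)).ne'
      simp [hφ0, hρ0, this]
  have hα : ∀ t, HasDerivAt (φ 0) (1 / p t) t := fun t => (hφ 0 t).congr_deriv (by ring)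
  have hω : Real.sin (φ 0 T) ≠ 0 := by
    intro h0
    obtain ⟨ρ, y1, hρ, hy, hy10⟩ := hsol 0
    rw [add_zero] at hy
    obtain ⟨hc2, hyd, hye⟩ := aux_sol_contDiff hV hy
    have h1 := (hΦ 0).2 _ hc2 hye
    rw [hyd] at h1
    have h2 := congrFun h1 1
    simp [Matrix.mulVec, dotProduct, Fin.sum_univ_two, hy10, hφ0, h0] at h2
    have h3 := (hΦ 0).1
    rw [Matrix.det_fin_two, h2] at h3
    rw [Matrix.trace_fin_two] at htr
    have h4 := htr.1
    have h5 := htr.2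
    nlinarith [sq_nonneg (Φ 0 0 0 - Φ 0 1 1)]
  obtain ⟨K, hK0, hK⟩ := aux_average p hp hpc T hT pper (φ 0) (hφ0 0) hα hω
  have hcount : ∀ x : ℝ, ∀ E : ℝ, dirichletCount V x E =
      {e' : ℝ | e' ≤ E ∧ ∃ n : ℤ, φ (e' - E₀) x = n * Real.pi}.ncard := by
    intro x E
    unfold dirichletCount
    congr 1
    ext E'
    simp only [mem_setOf_eq]
    refine and_congr_right fun _ => ?_
    obtain ⟨ρ, y1, hρ, hy, hy10⟩ := hsol (E' - E₀)
    rw [add_sub_cancel] at hy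
    have hpos : 0 < ρ x * Real.sqrt (p x) := mul_pos (hρ x) (Real.sqrt_pos.2 (hp x))
    have hz : (∃ n : ℤ, φ (E' - E₀) x = n * Real.pi) ↔
        ρ x * Real.sqrt (p x) * Real.sin (φ (E' - E₀) x) = 0 := by
      rw [mul_eq_zero, or_iff_right hpos.ne', Real.sin_eq_zero_iff]
      simp only [eq_comm]
    rw [hz]
    constructor
    · rintro ⟨u, hu2, hu0, hu1, hux, hue⟩
      have hu := aux_sol_of_contDiff hu2 hue
      obtain ⟨s, s1, c, c1, hs, hc, s0, s10, c0, c10⟩ := aux_fundamental (fun t => V t - E')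
        (by fun_prop) (Q + |E'|) (fun t => (abs_sub _ _).trans (by linarith [hVQ t]))
      have e1 := (aux_unique hs hc s0 s10 c0 c10 hu x).1
      have e2 := (aux_unique hs hc s0 s10 c0 c10 hy x).1
      simp only [hu0, hu1, hy10, hφ0, Real.sin_zero] at e1 e2
      simp only [one_mul, mul_zero, zero_mul, add_zero] at e1 e2
      rw [hux] at e1
      rw [e2]; exact e1.symm
    · intro h
      obtain ⟨hc2, hyd, hye⟩ := aux_sol_contDiff hV hy
      exact ⟨_, hc2, by simp [hφ0], by rw [hyd]; exact hy10, h, hye⟩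
  set P := ∫ t in (0:ℝ)..T, p t with hP
  have hPn : ∀ n : ℕ, ∫ t in (0:ℝ)..(n * T), p t = n * P := by
    intro n
    have := pper.intervalIntegral_add_zsmul_eq n 0 (fun _ _ => hpc.intervalIntegrable _ _)
    simpa using this
  have hinc : ∀ e : ℝ, 0 < e → e * (1/2 - 2 * K * e) * P / (Real.pi * T) ≤ k (E₀ + e) - k E₀ := by
    intro e he
    have hn : Tendsto (fun n : ℕ => (n : ℝ) * T) atTop atTop :=
      tendsto_natCast_atTop_atTop.atTop_mul_const hT
    have l1 := ((hk (E₀ + e)).comp hn).sub ((hk E₀).comp hn)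
    have l2 : Tendsto (fun n : ℕ => e * (1/2 - 2 * K * e) * P / (Real.pi * T)
        - (2 * K * e / Real.pi + 1) / ((n:ℝ) * T)) atTop
        (nhds (e * (1/2 - 2 * K * e) * P / (Real.pi * T) - 0)) :=
      tendsto_const_nhds.sub (tendsto_const_nhds.div_atTop hn)
    rw [sub_zero] at l2
    refine le_of_tendsto_of_tendsto l2 l1 ?_
    filter_upwards [eventually_gt_atTop 0] with n hn0
    have hn0' : (0:ℝ) < n := by exact_mod_cast hn0
    have hx : 0 < (n:ℝ) * T := by positivity
    simp only [Function.comp_apply, hcount]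
    have h1 := aux_count (fun E => φ (E - E₀) (n * T))
      (fun a b hab => aux_strict p hp hpc (a - E₀) (b - E₀) (by linarith) _ _ (hφ0 _) (hφ0 _)
        (hφ _) (hφ _) _ hx)
      ((aux_cont p hp B hB' φ hφ0 hφ _ hx.le).comp (continuous_id.sub continuous_const))
      (fun E => aux_nonneg p hp _ _ (hφ0 _) (hφ _) _ hx.le) E₀ (E₀ + e) (by linarith)
    have h2 := hK e he.le (φ e) (hφ0 e) (hφ e) (n * T) hx.le
    rw [hPn] at h2
    simp only [sub_self, add_sub_cancel_left] at h1
    rw [← sub_div, le_div_iff₀ hx]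
    have h3 : (e * (1/2 - 2 * K * e) * (n * P) - 2 * K * e) / Real.pi
        ≤ (φ e (n * T) - φ 0 (n * T)) / Real.pi := by
      apply div_le_div_of_nonneg_right _ hpi.le
      linarith
    have h4 : (e * (1/2 - 2 * K * e) * P / (Real.pi * T)
        - (2 * K * e / Real.pi + 1) / ((n:ℝ) * T)) * (n * T) =
        (e * (1/2 - 2 * K * e) * (n * P) - 2 * K * e) / Real.pi - 1 := by
      field_simp
      ring
    rw [h4]
    linarith
  have hder : P / (2 * Real.pi * T) ≤ k' := by
    have l1 := hk'.tendsto_slope_zero_right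
    have l2 : Tendsto (fun e : ℝ => (1/2 - 2 * K * e) * P / (Real.pi * T)) (nhdsWithin 0 (Ioi 0))
        (nhds ((1/2 - 2 * K * 0) * P / (Real.pi * T))) := by
      have : Continuous fun e : ℝ => (1/2 - 2 * K * e) * P / (Real.pi * T) := by fun_prop
      exact (this.tendsto 0).mono_left nhdsWithin_le_nhds
    have h3 : (1/2 - 2 * K * 0) * P / (Real.pi * T) ≤ k' := by
      refine le_of_tendsto_of_tendsto l2 l1 ?_
      filter_upwards [self_mem_nhdsWithin] with e he
      have he' : (0:ℝ) < e := he
      have := hinc e he'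
      rw [smul_eq_mul, inv_mul_eq_div, le_div_iff₀ he']
      refine le_trans (le_of_eq ?_) this
      ring
    refine le_trans (le_of_eq ?_) h3
    field_simp
    ring
  have hVc : Continuous fun t => (V t - E₀) * p t := by fun_prop
  have hqint : ∫ t in (0:ℝ)..T, (q t + (V t - E₀) * p t) = 0 := by
    rw [intervalIntegral.integral_eq_sub_of_hasDerivAt (fun t _ => hr' t)
      ((hqc.add hVc).intervalIntegrable _ _)]
    have := rper 0
    rw [zero_add] at this
    rw [this]; ring
  have hpq : ∫ t in (0:ℝ)..T, (p t + q t) ≤ (1 + Q + R) * P := by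
    have h1 : ∫ t in (0:ℝ)..T, (p t + q t) = ∫ t in (0:ℝ)..T, (p t - (V t - E₀) * p t) := by
      have h2 : ∫ t in (0:ℝ)..T, (p t + q t) =
          ∫ t in (0:ℝ)..T, ((q t + (V t - E₀) * p t) + (p t - (V t - E₀) * p t)) := by
        congr 1; ext t; ring
      have i1 : IntervalIntegrable (fun t => q t + (V t - E₀) * p t) volume 0 T :=
        (hqc.add hVc).intervalIntegrable _ _
      have i2 : IntervalIntegrable (fun t => p t - (V t - E₀) * p t) volume 0 T :=
        (hpc.sub hVc).intervalIntegrable _ _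
      rw [h2, intervalIntegral.integral_add i1 i2, hqint, zero_add]
    rw [h1, hP, ← intervalIntegral.integral_const_mul]
    refine intervalIntegral.integral_mono_on hT.le ((hpc.sub hVc).intervalIntegrable _ _)
      ((continuous_const.mul hpc).intervalIntegrable _ _) fun t _ => ?_
    have h3 := (abs_le.1 (hVQ t)).1
    have h4 := (abs_le.1 hE₀).2
    nlinarith [hp t]
  have hP0 : 0 ≤ P := intervalIntegral.integral_nonneg hT.le fun t _ => (hp t).le
  have hMint : ∫ t in (0 : ℝ)..T, matOpNorm (M t) ^ 2 ≤ (1 + Q + R) * P := by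
    by_cases hi : IntervalIntegrable (fun t => matOpNorm (M t) ^ 2) volume 0 T
    · exact (intervalIntegral.integral_mono_on hT.le hi ((hpc.add hqc).intervalIntegrable _ _)
        fun t _ => hMpq t).trans hpq
    · rw [intervalIntegral.integral_undef hi]; positivity
  calc 1 / (2 * Real.pi * (1 + Q + R)) / T * ∫ t in (0 : ℝ)..T, matOpNorm (M t) ^ 2
      ≤ 1 / (2 * Real.pi * (1 + Q + R)) / T * ((1 + Q + R) * P) :=
        mul_le_mul_of_nonneg_left hMint (by positivity)
    _ = P / (2 * Real.pi * T) := by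
        have : 1 + Q + R ≠ 0 := by positivity
        field_simp
    _ ≤ k' := hder
end
end

section
/- If V : ℝ → ℝ is continuous and T-periodic, then for each R > 0, the interval [-R,R] intersects at most (T/π)·√(R + ‖V‖_∞) + 1 bands of σ(H_V). -/
open MeasureTheory Filter Set BoundedContinuousFunction
open scoped ENNReal

noncomputable section
/-- The spectrum of the Schrödinger operator `H_V φ = -φ'' + Vφ` on `L²(ℝ)`, characterized
via Weyl sequences drawn from the core `C_c²(ℝ)` of the (essentially self-adjoint) operator:
`E ∈ σ(H_V)` iff there are compactly supported `C²` functions `u` of unit `L²` norm with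
`‖(H_V - E)u‖_{L²}` arbitrarily small. -/
def schrodingerSpectrum (V : ℝ → ℝ) : Set ℝ :=
  {E : ℝ | ∀ ε : ℝ, 0 < ε → ∃ u : ℝ → ℂ,
    ContDiff ℝ 2 u ∧ HasCompactSupport u ∧
    (∫ x : ℝ, ‖u x‖ ^ 2) = 1 ∧
    (∫ x : ℝ, ‖-deriv (deriv u) x + (V x : ℂ) * u x - (E : ℂ) * u x‖ ^ 2) < ε}
/-- Picard iterates. -/
noncomputable def picIt {X : Type*} [NormedAddCommGroup X] [NormedSpace ℝ X]
    (a : ℝ → ℝ → X →L[ℝ] X) (x0 : X) : ℕ → ℝ → ℝ → X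
  | 0 => fun _ _ => x0
  | n+1 => fun E x => ∫ t in (0:ℝ)..x, a E t (picIt a x0 n E t)

lemma picIt_cont {X : Type*} [NormedAddCommGroup X] [NormedSpace ℝ X] [CompleteSpace X]
    (a : ℝ → ℝ → X →L[ℝ] X) (ha : Continuous (Function.uncurry a)) (x0 : X) (n : ℕ) :
    Continuous (Function.uncurry (picIt a x0 n)) := by
  induction n with
  | zero => exact continuous_const
  | succ n ih =>
    have h : Continuous (Function.uncurry (fun E t => a E t (picIt a x0 n E t))) :=
      ha.clm_apply ih
    have h2 := intervalIntegral.continuous_parametric_intervalIntegral_of_continuous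
      (μ := volume) (a₀ := 0) (f := fun (p : ℝ × ℝ) t => a p.1 t (picIt a x0 n p.1 t))
      (s := fun p : ℝ × ℝ => p.2) (h.comp (by fun_prop : Continuous fun q : (ℝ × ℝ) × ℝ => (q.1.1, q.2)))
      continuous_snd
    exact h2

lemma picIt_deriv {X : Type*} [NormedAddCommGroup X] [NormedSpace ℝ X] [CompleteSpace X]
    (a : ℝ → ℝ → X →L[ℝ] X) (ha : Continuous (Function.uncurry a)) (x0 : X) (n : ℕ) (E x : ℝ) :
    HasDerivAt (picIt a x0 (n+1) E) (a E x (picIt a x0 n E x)) x := by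
  have h : Continuous (Function.uncurry (fun E t => a E t (picIt a x0 n E t))) :=
      ha.clm_apply (picIt_cont a ha x0 n)
  have h1 : Continuous (fun t => a E t (picIt a x0 n E t)) :=
    h.comp (by fun_prop : Continuous fun t : ℝ => (E, t))
  exact h1.integral_hasStrictDerivAt 0 x |>.hasDerivAt

lemma picIt_bound {X : Type*} [NormedAddCommGroup X] [NormedSpace ℝ X] [CompleteSpace X]
    (a : ℝ → ℝ → X →L[ℝ] X) (x0 : X) (r K : ℝ) (E : ℝ)
    (hK : ∀ t, |t| ≤ r → ‖a E t‖ ≤ K) (n : ℕ) :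
    ∀ x, |x| ≤ r → ‖picIt a x0 n E x‖ ≤ ‖x0‖ * ((K * |x|) ^ n / n.factorial) := by
  induction n with
  | zero => intro x _; simp [picIt]
  | succ n ih =>
    intro x hx
    have hr : 0 ≤ r := (abs_nonneg x).trans hx
    have hK0 : 0 ≤ K := (norm_nonneg _).trans (hK 0 (by simpa using hr))
    have key : ∀ t, |t| ≤ |x| → ‖a E t (picIt a x0 n E t)‖ ≤ ‖x0‖ * K^(n+1) / n.factorial * |t|^n := by
      intro t ht
      calc _ ≤ ‖a E t‖ * ‖picIt a x0 n E t‖ := ContinuousLinearMap.le_opNorm _ _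
        _ ≤ K * (‖x0‖ * ((K * |t|) ^ n / n.factorial)) := by
            gcongr
            · exact hK t (ht.trans hx)
            · exact ih t (ht.trans hx)
        _ = _ := by rw [mul_pow, pow_succ]; ring
    have hfin : ∀ y : ℝ, 0 ≤ y → ‖x0‖ * K^(n+1) / n.factorial * (y ^ (n+1) / (n+1)) =
        ‖x0‖ * ((K * y) ^ (n+1) / (n+1).factorial) := by
      intro y hy
      have := Nat.factorial_pos n
      rw [Nat.factorial_succ, mul_pow]; push_cast; field_simp
    simp only [picIt]
    rcases le_total 0 x with h0 | h0
    · calc _ ≤ ∫ t in (0:ℝ)..x, ‖x0‖ * K^(n+1) / n.factorial * t^n := by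
            apply intervalIntegral.norm_integral_le_of_norm_le h0
            · refine Eventually.of_forall fun t ht => ?_
              have := key t (by rw [abs_of_pos ht.1, abs_of_nonneg h0]; exact ht.2)
              rwa [abs_of_pos ht.1] at this
            · exact Continuous.intervalIntegrable (by fun_prop) _ _
        _ = _ := by
            rw [intervalIntegral.integral_const_mul, integral_pow, ← hfin _ (abs_nonneg x),
              abs_of_nonneg h0]; simp
    · rw [intervalIntegral.integral_symm, norm_neg]
      calc _ ≤ ∫ t in x..(0:ℝ), ‖x0‖ * K^(n+1) / n.factorial * (-t)^n := by
            apply intervalIntegral.norm_integral_le_of_norm_le h0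
            · refine Eventually.of_forall fun t ht => ?_
              have := key t (by rw [abs_of_nonpos ht.2, abs_of_nonpos h0]; linarith [ht.1])
              rwa [abs_of_nonpos ht.2] at this
            · exact Continuous.intervalIntegrable (by fun_prop) _ _
        _ = _ := by
            rw [intervalIntegral.integral_const_mul,
              intervalIntegral.integral_comp_neg (fun t => t^n), integral_pow,
              ← hfin _ (abs_nonneg x), abs_of_nonpos h0]; simp

lemma linODE {X : Type*} [NormedAddCommGroup X] [NormedSpace ℝ X] [CompleteSpace X]
    (a : ℝ → ℝ → X →L[ℝ] X) (ha : Continuous (Function.uncurry a)) (x0 : X) :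
    ∃ Y : ℝ → ℝ → X, Continuous (Function.uncurry Y) ∧ (∀ E, Y E 0 = x0) ∧
      ∀ E x, HasDerivAt (Y E) (a E x (Y E x)) x := by
  have hb : ∀ r : ℝ, ∃ K, ∀ E t : ℝ, |E| ≤ r → |t| ≤ r → ‖a E t‖ ≤ K := by
    intro r
    obtain ⟨K, hK⟩ := ((isCompact_Icc (a := -r) (b := r)).prod
      (isCompact_Icc (a := -r) (b := r))).exists_bound_of_continuousOn ha.continuousOn
    exact ⟨K, fun E t hE ht => hK (E, t) ⟨abs_le.1 hE, abs_le.1 ht⟩⟩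
  -- uniform bounds
  have hu : ∀ r : ℝ, ∃ K, 0 ≤ K ∧ (∀ E t : ℝ, |E| ≤ r → |t| ≤ r → ‖a E t‖ ≤ K) ∧
      ∀ n E t, |E| ≤ r → |t| ≤ r → ‖picIt a x0 n E t‖ ≤ ‖x0‖ * ((K * r) ^ n / n.factorial) := by
    intro r
    obtain ⟨K, hK⟩ := hb r
    refine ⟨max K 0, le_max_right _ _, fun E t hE ht => (hK E t hE ht).trans (le_max_left _ _), ?_⟩
    intro n E t hE ht
    refine (picIt_bound a x0 r (max K 0) E
      (fun t ht => (hK E t hE ht).trans (le_max_left _ _)) n t ht).trans ?_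
    gcongr
  have hs : ∀ c : ℝ, Summable fun n : ℕ => ‖x0‖ * (c ^ n / n.factorial) := fun c =>
    (Real.summable_pow_div_factorial c).mul_left _
  have hsum : ∀ E x, Summable fun n => picIt a x0 n E x := by
    intro E x
    obtain ⟨K, hK0, hK, hn⟩ := hu (max |E| |x|)
    exact Summable.of_norm_bounded (hs _) fun n => hn n E x (le_max_left _ _) (le_max_right _ _)
  refine ⟨fun E x => ∑' n, picIt a x0 n E x, ?_, ?_, ?_⟩
  · rw [continuous_iff_continuousAt]
    rintro ⟨E, x⟩
    set r := max |E| |x| + 1 with hr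
    obtain ⟨K, hK0, hK, hn⟩ := hu r
    have : ContinuousOn (fun p : ℝ × ℝ => ∑' n, Function.uncurry (picIt a x0 n) p)
        {p | |p.1| < r ∧ |p.2| < r} := by
      refine continuousOn_tsum (fun n => (picIt_cont a ha x0 n).continuousOn) (hs (K * r)) ?_
      rintro n ⟨p, q⟩ ⟨h1, h2⟩
      exact hn n p q h1.le h2.le
    refine this.continuousAt ?_
    refine IsOpen.mem_nhds ?_ ?_
    · exact (isOpen_lt (continuous_fst.abs) continuous_const).inter
        (isOpen_lt (continuous_snd.abs) continuous_const)
    · exact ⟨by simp only [hr]; linarith [le_max_left |E| |x|],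
        by simp only [hr]; linarith [le_max_right |E| |x|]⟩
  · intro E
    beta_reduce
    rw [tsum_eq_single 0]
    · rfl
    · intro n hn
      obtain ⟨m, rfl⟩ := Nat.exists_eq_succ_of_ne_zero hn
      simp [picIt]
  · intro E x
    set r := max |E| |x| + 1 with hr
    obtain ⟨K, hK0, hK, hn⟩ := hu r
    have hE : |E| ≤ r := by simp only [hr]; linarith [le_max_left |E| |x|]
    have hx : |x| < r := by simp only [hr]; linarith [le_max_right |E| |x|]
    have hmem : ∀ y, y ∈ Metric.ball (0:ℝ) r ↔ |y| < r := fun y => by simp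
    have h := hasDerivAt_tsum_of_isPreconnected (g := fun n => picIt a x0 (n+1) E)
      (g' := fun n y => a E y (picIt a x0 n E y)) (t := Metric.ball 0 r) (y₀ := x) (y := x)
      ((hs (K * r)).mul_left K) Metric.isOpen_ball (convex_ball _ _).isPreconnected
      (fun n y _ => picIt_deriv a ha x0 n E y)
      (fun n y hy => by
        have hy := (hmem y).1 hy
        refine (ContinuousLinearMap.le_opNorm _ _).trans ?_
        gcongr
        · exact hK E y hE hy.le
        · exact hn n E y hE hy.le)
      ((hmem x).2 hx) ((summable_nat_add_iff 1).2 (hsum E x)) ((hmem x).2 hx)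
    rw [ContinuousLinearMap.map_tsum _ (hsum E x)]
    have h3 : (fun x => ∑' n, picIt a x0 n E x) = fun x => x0 + ∑' n, picIt a x0 (n+1) E x := by
      funext y
      rw [(hsum E y).tsum_eq_zero_add]; rfl
    beta_reduce
    rw [h3]
    exact h.const_add x0

lemma schrodSol (V : ℝ → ℝ) (hV : Continuous V) (p0 p1 : ℝ) :
    ∃ y z : ℝ → ℝ → ℝ, Continuous (Function.uncurry y) ∧ Continuous (Function.uncurry z) ∧
      (∀ E, y E 0 = p0) ∧ (∀ E, z E 0 = p1) ∧ (∀ E x, HasDerivAt (y E) (z E x) x) ∧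
      (∀ E x, HasDerivAt (z E) ((V x - E) * y E x) x) := by
  obtain ⟨Y, hc, h0, hd⟩ := linODE (X := ℝ × ℝ)
    (fun E t => (ContinuousLinearMap.inl ℝ ℝ ℝ).comp (ContinuousLinearMap.snd ℝ ℝ ℝ) +
      (V t - E) • (ContinuousLinearMap.inr ℝ ℝ ℝ).comp (ContinuousLinearMap.fst ℝ ℝ ℝ))
    (by
      have h1 : Continuous fun p : ℝ × ℝ => V p.2 - p.1 := by fun_prop
      exact continuous_const.add (h1.smul continuous_const)) (p0, p1)
  refine ⟨fun E x => (Y E x).1, fun E x => (Y E x).2, continuous_fst.comp hc,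
    continuous_snd.comp hc, fun E => by simp [h0], fun E => by simp [h0], ?_, ?_⟩
  · intro E x
    have := (hasFDerivAt_fst (𝕜 := ℝ) (p := Y E x)).comp_hasDerivAt x (hd E x)
    simpa [Function.comp_def] using this
  · intro E x
    have := (hasFDerivAt_snd (𝕜 := ℝ) (p := Y E x)).comp_hasDerivAt x (hd E x)
    simpa [Function.comp_def] using this

lemma sturm_pos {u u' v v' q1 q2 : ℝ → ℝ} {a b : ℝ} (hab : a < b)
    (hu : ∀ x, HasDerivAt u (u' x) x) (hu' : ∀ x, HasDerivAt u' (q1 x * u x) x)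
    (hv : ∀ x, HasDerivAt v (v' x) x) (hv' : ∀ x, HasDerivAt v' (q2 x * v x) x)
    (hq : ∀ x, q2 x < q1 x) (ha : u a = 0) (hb : u b = 0)
    (hup : ∀ x ∈ Ioo a b, 0 < u x) (hvp : ∀ x ∈ Ioo a b, 0 < v x) : False := by
  have huc : Continuous u := continuous_iff_continuousAt.2 fun x => (hu x).continuousAt
  have hvc : Continuous v := continuous_iff_continuousAt.2 fun x => (hv x).continuousAt
  have hcl : ∀ x ∈ Icc a b, 0 ≤ v x := by
    intro x hx
    rw [← closure_Ioo hab.ne] at hx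
    exact closure_minimal (fun y hy => (hvp y hy).le) (isClosed_le continuous_const hvc) hx
  have hA : 0 ≤ u' a := by
    have := (hasDerivAt_iff_tendsto_slope.1 (hu a)).mono_left
      (nhdsWithin_mono a (fun y (hy : y ∈ Ioi a) => ne_of_gt hy))
    refine ge_of_tendsto this ?_
    filter_upwards [Ioo_mem_nhdsGT hab] with y hy
    rw [slope_def_field, ha, sub_zero]
    exact div_nonneg (hup y hy).le (sub_nonneg.2 hy.1.le)
  have hB : u' b ≤ 0 := by
    have := (hasDerivAt_iff_tendsto_slope.1 (hu b)).mono_left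
      (nhdsWithin_mono b (fun y (hy : y ∈ Iio b) => ne_of_lt hy))
    refine le_of_tendsto this ?_
    filter_upwards [Ioo_mem_nhdsLT hab] with y hy
    rw [slope_def_field, hb, sub_zero]
    exact div_nonpos_of_nonneg_of_nonpos (hup y hy).le (sub_nonpos.2 hy.2.le)
  have hW : ∀ x, HasDerivAt (fun x => u' x * v x - u x * v' x) ((q1 x - q2 x) * (u x * v x)) x := by
    intro x
    exact HasDerivAt.congr_deriv (((hu' x).mul (hv x)).sub ((hu x).mul (hv' x))) (by ring)
  have hm : StrictMonoOn (fun x => u' x * v x - u x * v' x) (Icc a b) := by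
    refine strictMonoOn_of_deriv_pos (convex_Icc a b)
      (fun x _ => (hW x).continuousAt.continuousWithinAt) ?_
    intro x hx
    rw [interior_Icc] at hx
    rw [(hW x).deriv]
    exact mul_pos (sub_pos.2 (hq x)) (mul_pos (hup x hx) (hvp x hx))
  have := hm (left_mem_Icc.2 hab.le) (right_mem_Icc.2 hab.le) hab
  simp only [ha, hb, zero_mul, sub_zero] at this
  have h1 := mul_nonneg hA (hcl a (left_mem_Icc.2 hab.le))
  have h2 := mul_nonneg (neg_nonneg.2 hB) (hcl b (right_mem_Icc.2 hab.le))
  linarith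

lemma sign_const {f : ℝ → ℝ} {s : Set ℝ} (hs : IsPreconnected s) (hf : ContinuousOn f s)
    (h : ∀ x ∈ s, f x ≠ 0) : (∀ x ∈ s, 0 < f x) ∨ (∀ x ∈ s, f x < 0) := by
  by_contra hcon
  push Not at hcon
  obtain ⟨⟨x, hx, hx0⟩, ⟨y, hy, hy0⟩⟩ := hcon
  obtain ⟨z, hz, hz0⟩ := hs.intermediate_value hx hy hf ⟨hx0, hy0⟩
  exact h z hz hz0

lemma sturm {u u' v v' q1 q2 : ℝ → ℝ} {a b c : ℝ} (hac : a < c) (hcb : c < b)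
    (hu : ∀ x, HasDerivAt u (u' x) x) (hu' : ∀ x, HasDerivAt u' (q1 x * u x) x)
    (hv : ∀ x, HasDerivAt v (v' x) x) (hv' : ∀ x, HasDerivAt v' (q2 x * v x) x)
    (hq : ∀ x, q2 x < q1 x) (ha : u a = 0) (hb : u b = 0) (hc : u c ≠ 0) :
    ∃ z ∈ Ioo a b, v z = 0 := by
  have huc : Continuous u := continuous_iff_continuousAt.2 fun x => (hu x).continuousAt
  have hvc : Continuous v := continuous_iff_continuousAt.2 fun x => (hv x).continuousAt
  have hZ : IsClosed {x | u x = 0} := isClosed_eq huc continuous_const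
  obtain ⟨a', ⟨ha'1, ha'2⟩, ha'3⟩ := ((isCompact_Icc (a := a) (b := c)).inter_right hZ).exists_isGreatest
    ⟨a, left_mem_Icc.2 hac.le, ha⟩
  obtain ⟨b', ⟨hb'1, hb'2⟩, hb'3⟩ := ((isCompact_Icc (a := c) (b := b)).inter_right hZ).exists_isLeast
    ⟨b, right_mem_Icc.2 hcb.le, hb⟩
  have h1 : a' < c := lt_of_le_of_ne ha'1.2 (fun h => hc (h ▸ ha'2))
  have h2 : c < b' := lt_of_le_of_ne hb'1.1 (fun h => hc (h ▸ hb'2))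
  have hne : ∀ x ∈ Ioo a' b', u x ≠ 0 := by
    intro x hx h0
    rcases le_total x c with h | h
    · exact absurd (ha'3 ⟨⟨ha'1.1.trans hx.1.le, h⟩, h0⟩) (not_le.2 hx.1)
    · exact absurd (hb'3 ⟨⟨h, hx.2.le.trans hb'1.2⟩, h0⟩) (not_le.2 hx.2)
  by_contra hcon
  push Not at hcon
  have hvne : ∀ x ∈ Ioo a' b', v x ≠ 0 := fun x hx =>
    hcon x ⟨lt_of_le_of_lt ha'1.1 hx.1, lt_of_lt_of_le hx.2 hb'1.2⟩
  have hlt := h1.trans h2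
  have nu : ∀ x, HasDerivAt (fun x => - u x) (- u' x) x := fun x => (hu x).neg
  have nu' : ∀ x, HasDerivAt (fun x => - u' x) (q1 x * (- u x)) x := fun x => by
    exact HasDerivAt.congr_deriv ((hu' x).neg) (by ring)
  have nv : ∀ x, HasDerivAt (fun x => - v x) (- v' x) x := fun x => (hv x).neg
  have nv' : ∀ x, HasDerivAt (fun x => - v' x) (q2 x * (- v x)) x := fun x => by
    exact HasDerivAt.congr_deriv ((hv' x).neg) (by ring)
  have na : -u a' = 0 := by rw [show u a' = 0 from ha'2]; simp
  have nb : -u b' = 0 := by rw [show u b' = 0 from hb'2]; simp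
  rcases sign_const isPreconnected_Ioo huc.continuousOn hne with h | h <;>
  rcases sign_const isPreconnected_Ioo hvc.continuousOn hvne with h' | h'
  · exact sturm_pos hlt hu hu' hv hv' hq ha'2 hb'2 h h'
  · exact sturm_pos hlt hu hu' nv nv' hq ha'2 hb'2 h (fun x hx => neg_pos.2 (h' x hx))
  · exact sturm_pos hlt nu nu' hv hv' hq na nb (fun x hx => neg_pos.2 (h x hx)) h'
  · exact sturm_pos hlt nu nu' nv nv' hq na nb (fun x hx => neg_pos.2 (h x hx))
      (fun x hx => neg_pos.2 (h' x hx))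

/-- The normalized solutions. -/
structure FundSys (V : ℝ → ℝ) (c c' s s' : ℝ → ℝ → ℝ) : Prop where
  cc : Continuous (Function.uncurry c)
  cs : Continuous (Function.uncurry s)
  cc' : Continuous (Function.uncurry c')
  cs' : Continuous (Function.uncurry s')
  c0 : ∀ E, c E 0 = 1
  c0' : ∀ E, c' E 0 = 0
  s0 : ∀ E, s E 0 = 0
  s0' : ∀ E, s' E 0 = 1
  dc : ∀ E x, HasDerivAt (c E) (c' E x) x
  dc' : ∀ E x, HasDerivAt (c' E) ((V x - E) * c E x) x
  ds : ∀ E x, HasDerivAt (s E) (s' E x) x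
  ds' : ∀ E x, HasDerivAt (s' E) ((V x - E) * s E x) x

section
variable {V : ℝ → ℝ} {c c' s s' : ℝ → ℝ → ℝ}

lemma FundSys.wronsk (h : FundSys V c c' s s') (E x : ℝ) :
    c E x * s' E x - c' E x * s E x = 1 := by
  have hW : ∀ x, HasDerivAt (fun x => c E x * s' E x - c' E x * s E x) 0 x := by
    intro x
    exact HasDerivAt.congr_deriv (((h.dc E x).mul (h.ds' E x)).sub ((h.dc' E x).mul (h.ds E x))) (by ring)
  have := is_const_of_deriv_eq_zero (fun x => (hW x).differentiableAt) (fun x => (hW x).deriv) x 0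
  simpa [h.c0, h.c0', h.s0, h.s0'] using this

lemma FundSys.exists_ne (h : FundSys V c c' s s') (E : ℝ) {a b : ℝ} (hab : a < b) :
    ∃ x, a < x ∧ x < b ∧ s E x ≠ 0 := by
  by_contra hcon
  push Not at hcon
  obtain ⟨m, hm1, hm2⟩ := exists_between hab
  have h0 : s' E m = 0 := by
    refine (h.ds E m).unique ?_
    refine (hasDerivAt_const m (0:ℝ)).congr_of_eventuallyEq ?_
    filter_upwards [Ioo_mem_nhds hm1 hm2] with y hy using hcon y hy.1 hy.2
  have := h.wronsk E m
  rw [h0, hcon m hm1 hm2] at this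
  simp at this

lemma FundSys.interlace (h : FundSys V c c' s s') {E E' : ℝ} (hE : E < E') {a b : ℝ} (hab : a < b)
    (ha : s E a = 0) (hb : s E b = 0) : ∃ z, a < z ∧ z < b ∧ s E' z = 0 := by
  obtain ⟨m, h1, h2, h3⟩ := h.exists_ne E hab
  obtain ⟨z, hz, h0⟩ := sturm h1 h2 (h.ds E) (h.ds' E) (h.ds E') (h.ds' E')
    (fun x => by linarith) ha hb h3
  exact ⟨z, hz.1, hz.2, h0⟩

lemma FundSys.spacing (h : FundSys V c c' s s') {E k : ℝ} (hk : 0 < k)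
    (hE : ∀ x, E - V x < k ^ 2) {a b : ℝ} (hab : a < b)
    (ha : s E a = 0) (hb : s E b = 0) : Real.pi / k ≤ b - a := by
  by_contra hcon
  push Not at hcon
  obtain ⟨m, h1, h2, h3⟩ := h.exists_ne E hab
  have hd : ∀ x, HasDerivAt (fun x => k * (x - a)) k x := fun x => by
    simpa using ((hasDerivAt_id x).sub_const a).const_mul k
  obtain ⟨z, hz, h0⟩ := sturm (v := fun x => Real.sin (k * (x - a)))
    (v' := fun x => k * Real.cos (k * (x - a))) (q2 := fun _ => -k^2) h1 h2 (h.ds E) (h.ds' E)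
    (fun x => by exact HasDerivAt.congr_deriv ((hd x).sin) (by ring))
    (fun x => by exact HasDerivAt.congr_deriv (((hd x).cos).const_mul k) (by ring))
    (fun x => by linarith [hE x]) ha hb h3
  have hp : 0 < Real.sin (k * (z - a)) := by
    apply Real.sin_pos_of_pos_of_lt_pi
    · exact mul_pos hk (sub_pos.2 hz.1)
    · rw [lt_div_iff₀ hk] at hcon
      nlinarith [hz.2]
  exact hp.ne' h0

lemma FundSys.zeros (h : FundSys V c c' s s') {T : ℝ} (hT : 0 < T) (μ : ℕ → ℝ) (n : ℕ)
    (hmu : ∀ i, i < n → μ i < μ (i+1)) (h0 : ∀ i, i ≤ n → s (μ i) T = 0) :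
    ∃ z : ℕ → ℝ, z 0 = 0 ∧ z (n+1) = T ∧ (∀ i, i ≤ n → z i < z (i+1)) ∧
      ∀ i, i ≤ n + 1 → s (μ n) (z i) = 0 := by
  induction n with
  | zero =>
    refine ⟨fun i => if i = 0 then 0 else T, by simp, by simp, ?_, ?_⟩
    · intro i hi
      obtain rfl : i = 0 := by omega
      simpa using hT
    · intro i hi
      by_cases hi0 : i = 0
      · simp [hi0, h.s0]
      · simp [hi0, h0]
  | succ n ih =>
    obtain ⟨z, z0, zT, zm, zz⟩ := ih (fun i hi => hmu i (by omega)) (fun i hi => h0 i (by omega))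
    have : ∀ i, ∃ w, i ≤ n → (z i < w ∧ w < z (i+1) ∧ s (μ (n+1)) w = 0) := by
      intro i
      by_cases hi : i ≤ n
      · obtain ⟨w, hw⟩ := h.interlace (hmu n (by omega)) (zm i hi) (zz i (by omega)) (zz (i+1) (by omega))
        exact ⟨w, fun _ => hw⟩
      · exact ⟨0, fun h => absurd h hi⟩
    choose w hw using this
    refine ⟨fun i => if i = 0 then 0 else if i = n + 2 then T else w (i-1), by simp, by simp, ?_, ?_⟩
    · intro i hi
      rcases Nat.eq_zero_or_pos i with rfl | hi0
      · simp
        simpa [z0] using (hw 0 (by omega)).1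
      · obtain ⟨j, rfl⟩ : ∃ j, i = j + 1 := ⟨i-1, by omega⟩
        have e1 : ¬ (j + 1 = n + 2) := by omega
        by_cases hj : j = n
        · subst hj
          simpa [zT] using (hw j le_rfl).2.1
        · have e2 : ¬ (j + 1 + 1 = n + 2) := by omega
          simp only [Nat.add_sub_cancel]
          rw [if_neg (by omega), if_neg (by omega), if_neg (by omega), if_neg (by omega)]
          exact (hw j (by omega)).2.1.trans (hw (j+1) (by omega)).1
    · intro i hi
      by_cases hi0 : i = 0
      · simp [hi0, h.s0]
      · by_cases hi1 : i = n + 2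
        · simp [hi1, h0]
        · simp only [hi0, hi1, if_false]
          exact (hw (i-1) (by omega)).2.2

lemma FundSys.count (h : FundSys V c c' s s') {T : ℝ} (hT : 0 < T) (μ : ℕ → ℝ) (n : ℕ)
    (hmu : ∀ i, i < n → μ i < μ (i+1)) (h0 : ∀ i, i ≤ n → s (μ i) T = 0) (M : ℝ)
    (hM : ∀ x, μ n - V x ≤ M) : (n + 1 : ℝ) ≤ T / Real.pi * Real.sqrt M := by
  obtain ⟨z, z0, zT, zm, zz⟩ := h.zeros hT μ n hmu h0
  have key : ∀ k, Real.sqrt M < k → (n + 1 : ℝ) ≤ T / Real.pi * k := by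
    intro k hk
    have hk0 : 0 < k := (Real.sqrt_nonneg M).trans_lt hk
    have hMk : M < k ^ 2 := (Real.sqrt_lt' hk0).1 hk
    have hz : ∀ i : ℕ, i ≤ n + 1 → i * (Real.pi / k) ≤ z i := by
      intro i
      induction i with
      | zero => intro _; simp [z0]
      | succ i ih =>
        intro hi
        have h1 := ih (by omega)
        have h2 := h.spacing hk0 (fun x => (hM x).trans_lt hMk) (zm i (by omega)) (zz i (by omega))
          (zz (i+1) hi)
        push_cast
        linarith
    have := hz (n+1) le_rfl
    rw [zT] at this
    push_cast at this
    have hpi := Real.pi_pos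
    rw [← mul_div_assoc, div_le_iff₀ hk0] at this
    rw [div_mul_eq_mul_div, le_div_iff₀ hpi]
    exact this
  refine ge_of_tendsto (x := nhdsWithin (Real.sqrt M) (Ioi (Real.sqrt M)))
    (f := fun k => T / Real.pi * k) ?_ ?_
  · exact (Continuous.tendsto (by fun_prop) _).mono_left nhdsWithin_le_nhds
  · filter_upwards [self_mem_nhdsWithin] with k hk using key k hk

/-- Monotonicity of the Dirichlet-to-Neumann form. -/
lemma FundSys.anti (h : FundSys V c c' s s') {T : ℝ} (hT : 0 < T) (σ : ℝ) (hσ : σ ^ 2 = 1)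
    {E1 E2 : ℝ} (hne : ∀ E ∈ Icc E1 E2, s E T ≠ 0) :
    AntitoneOn (fun E => (c E T + s' E T - 2 * σ) / s E T) (Icc E1 E2) := by
  set m : ℝ → ℝ := fun E => (σ - c E T) / s E T with hm
  set y : ℝ → ℝ → ℝ := fun E x => c E x + m E * s E x with hy
  set y' : ℝ → ℝ → ℝ := fun E x => c' E x + m E * s' E x with hy'
  set Q : ℝ → ℝ := fun E => (c E T + s' E T - 2 * σ) / s E T with hQ
  have dy : ∀ E x, HasDerivAt (y E) (y' E x) x := fun E x => (h.dc E x).add ((h.ds E x).const_mul _)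
  have dy' : ∀ E x, HasDerivAt (y' E) ((V x - E) * y E x) x := fun E x => by
    exact HasDerivAt.congr_deriv ((h.dc' E x).add ((h.ds' E x).const_mul (m E))) (by
      change _ = (V x - E) * (c E x + m E * s E x); ring)
  have yc : ∀ E, Continuous (y E) := fun E => continuous_iff_continuousAt.2 fun x => (dy E x).continuousAt
  have y0 : ∀ E, y E 0 = 1 := fun E => by simp [hy, h.c0, h.s0]
  have y0' : ∀ E, y' E 0 = m E := fun E => by simp [hy', h.c0', h.s0']
  have yT : ∀ E, s E T ≠ 0 → y E T = σ := fun E hE => by simp only [hy, hm]; field_simp; ring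
  have Qe : ∀ E, s E T ≠ 0 → Q E = - y' E 0 + σ * y' E T := fun E hE => by
    have hw := h.wronsk E T
    rw [y0']
    simp only [hy', hm, hQ]
    field_simp
    linear_combination σ * hw - s' E T * hσ
  have diff : ∀ E E', s E T ≠ 0 → s E' T ≠ 0 →
      Q E' - Q E = -(E' - E) * ∫ x in (0:ℝ)..T, y E x * y E' x := by
    intro E E' hE hE'
    have hW : ∀ x, HasDerivAt (fun x => y E x * y' E' x - y' E x * y E' x)
        (-(E' - E) * (y E x * y E' x)) x := by
      intro x
      exact HasDerivAt.congr_deriv (((dy E x).mul (dy' E' x)).sub ((dy' E x).mul (dy E' x))) (by ring)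
    have := intervalIntegral.integral_eq_sub_of_hasDerivAt (a := 0) (b := T) (fun x _ => hW x)
      (Continuous.intervalIntegrable (by have := yc E; have := yc E'; fun_prop) _ _)
    rw [intervalIntegral.integral_const_mul, yT E hE, yT E' hE', y0, y0] at this
    rw [this, Qe E hE, Qe E' hE']
    ring
  have cs : Continuous fun E => s E T := h.cs.comp (by fun_prop : Continuous fun E : ℝ => (E, T))
  have cc : Continuous fun E => c E T := h.cc.comp (by fun_prop : Continuous fun E : ℝ => (E, T))
  have hder : ∀ E, s E T ≠ 0 → HasDerivAt Q (-∫ x in (0:ℝ)..T, y E x * y E x) E := by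
    intro E hE
    rw [hasDerivAt_iff_tendsto_slope]
    have hcm : ContinuousAt m E := (continuousAt_const.sub cc.continuousAt).div cs.continuousAt hE
    have I1 : Continuous fun E' => ∫ x in (0:ℝ)..T, y E x * c E' x := by
      apply intervalIntegral.continuous_parametric_intervalIntegral_of_continuous' 
      exact ((yc E).comp continuous_snd).mul h.cc
    have I2 : Continuous fun E' => ∫ x in (0:ℝ)..T, y E x * s E' x := by
      apply intervalIntegral.continuous_parametric_intervalIntegral_of_continuous' 
      exact ((yc E).comp continuous_snd).mul h.cs
    have hI : ContinuousAt (fun E' => -((∫ x in (0:ℝ)..T, y E x * c E' x) +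
        m E' * ∫ x in (0:ℝ)..T, y E x * s E' x)) E :=
      (I1.continuousAt.add (hcm.mul I2.continuousAt)).neg
    have hIe : ∀ E', (∫ x in (0:ℝ)..T, y E x * y E' x) = (∫ x in (0:ℝ)..T, y E x * c E' x) +
        m E' * ∫ x in (0:ℝ)..T, y E x * s E' x := by
      intro E'
      have a1 : Continuous (c E') := h.cc.comp (by fun_prop : Continuous fun x : ℝ => (E', x))
      have a2 : Continuous (s E') := h.cs.comp (by fun_prop : Continuous fun x : ℝ => (E', x))
      have a3 := yc E
      rw [← intervalIntegral.integral_const_mul, ← intervalIntegral.integral_add]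
      · congr 1; funext x; simp only [hy]; ring
      · exact Continuous.intervalIntegrable (by fun_prop) _ _
      · exact Continuous.intervalIntegrable (by fun_prop) _ _
    have ht := hI.tendsto.mono_left (nhdsWithin_le_nhds (s := {E}ᶜ))
    rw [← hIe] at ht
    refine ht.congr' ?_
    filter_upwards [self_mem_nhdsWithin, nhdsWithin_le_nhds (cs.continuousAt.eventually_ne hE)]
      with E' h1 h2
    have h3 : E' - E ≠ 0 := sub_ne_zero.2 h1
    rw [slope_def_field, diff E E' hE h2, ← hIe]
    field_simp
  refine antitoneOn_of_deriv_nonpos (convex_Icc _ _)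
    (fun E hE => (hder E (hne E hE)).continuousAt.continuousWithinAt)
    (fun E hE => (hder E (hne E (interior_subset hE))).differentiableAt.differentiableWithinAt) ?_
  intro E hE
  rw [(hder E (hne E (interior_subset hE))).deriv, neg_nonpos]
  exact intervalIntegral.integral_nonneg hT.le fun x _ => mul_self_nonneg _

lemma FundSys.gap (h : FundSys V c c' s s') {T : ℝ} (hT : 0 < T) {E1 E2 : ℝ}
    (h1 : c E1 T + s' E1 T ∈ Ioo (-2:ℝ) 2) (h2 : c E2 T + s' E2 T ∈ Ioo (-2:ℝ) 2)
    (hne : ∀ E ∈ Icc E1 E2, s E T ≠ 0) : ∀ E ∈ Icc E1 E2, c E T + s' E T ∈ Ioo (-2:ℝ) 2 := by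
  intro E hE
  have cs : Continuous fun E => s E T := h.cs.comp (by fun_prop : Continuous fun E : ℝ => (E, T))
  have hle := hE.1.trans hE.2
  have m1 : E1 ∈ Icc E1 E2 := left_mem_Icc.2 hle
  have m2 : E2 ∈ Icc E1 E2 := right_mem_Icc.2 hle
  have P := h.anti hT 1 (by norm_num) hne
  have N := h.anti hT (-1) (by norm_num) hne
  have P1 := P m1 hE hE.1
  have P2 := P hE m2 hE.2
  have N1 := N m1 hE hE.1
  have N2 := N hE m2 hE.2
  simp only at P1 P2 N1 N2
  rcases sign_const isPreconnected_Icc cs.continuousOn hne with hs | hs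
  · constructor
    · have : 0 < (c E2 T + s' E2 T - 2 * -1) / s E2 T := div_pos (by linarith [h2.1]) (hs E2 m2)
      have := (div_pos_iff_of_pos_right (hs E hE)).1 (this.trans_le N2)
      linarith
    · have : (c E1 T + s' E1 T - 2 * 1) / s E1 T < 0 := div_neg_of_neg_of_pos (by linarith [h1.2]) (hs E1 m1)
      have := P1.trans_lt this
      rw [div_lt_iff₀ (hs E hE)] at this
      linarith
  · constructor
    · have : (c E1 T + s' E1 T - 2 * -1) / s E1 T < 0 := div_neg_of_pos_of_neg (by linarith [h1.1]) (hs E1 m1)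
      have h3 := N1.trans_lt this
      rw [div_lt_iff_of_neg (hs E hE)] at h3
      linarith
    · have : 0 < (c E2 T + s' E2 T - 2 * 1) / s E2 T := div_pos_of_neg_of_neg (by linarith [h2.2]) (hs E2 m2)
      have h3 := this.trans_le P2
      rw [lt_div_iff_of_neg (hs E hE)] at h3
      linarith

lemma FundSys.disc (h : FundSys V c c' s s') {T E : ℝ} (h0 : s E T = 0) :
    ¬ (c E T + s' E T ∈ Ioo (-2:ℝ) 2) := by
  rintro ⟨h1, h2⟩
  have := h.wronsk E T
  rw [h0] at this
  nlinarith [sq_nonneg (c E T - s' E T)]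

end

lemma band_key (V : ℝ → ℝ) (T : ℝ) (hT : 0 < T) {c c' s s' : ℝ → ℝ → ℝ}
    (h : FundSys V c c' s s') (D : ℝ → ℝ) (hD : ∀ E, D E = c E T + s' E T) (R M : ℝ)
    (hM : ∀ x, |V x| ≤ M) (n : ℕ) (F : Finset (Set ℝ)) (hcard : F.card = n + 1)
    (hF : ∀ B ∈ F, (∃ E ∈ {E : ℝ | D E ∈ Set.Ioo (-2 : ℝ) 2},
        B = closure (connectedComponentIn {E : ℝ | D E ∈ Set.Ioo (-2 : ℝ) 2} E)) ∧
      (B ∩ Set.Icc (-R) R).Nonempty) : (n : ℝ) ≤ T / Real.pi * Real.sqrt (R + M) := by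
  set O : Set ℝ := {E : ℝ | D E ∈ Set.Ioo (-2 : ℝ) 2} with hO
  have hex : ∀ B : Set ℝ, ∃ E : ℝ, B ∈ F → E ∈ O ∧ B = closure (connectedComponentIn O E) := by
    intro B
    by_cases hB : B ∈ F
    · obtain ⟨⟨E, h1, h2⟩, -⟩ := hF B hB
      exact ⟨E, fun _ => ⟨h1, h2⟩⟩
    · exact ⟨0, fun h => absurd h hB⟩
  choose e he using hex
  have hinj : Set.InjOn e F := by
    intro B hB B' hB' hBB
    rw [(he B hB).2, (he B' hB').2, hBB]
  have hG : (F.image e).card = n + 1 := by rw [Finset.card_image_of_injOn hinj, hcard]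
  set g := (F.image e).orderEmbOfFin hG with hg
  have gm : ∀ i, g i ∈ O ∧ (closure (connectedComponentIn O (g i)) ∩ Set.Icc (-R) R).Nonempty := by
    intro i
    obtain ⟨B, hB, hBe⟩ := Finset.mem_image.1 ((F.image e).orderEmbOfFin_mem hG i)
    rw [← hg] at hBe
    rw [← hBe]
    refine ⟨(he B hB).1, ?_⟩
    rw [← (he B hB).2]
    exact (hF B hB).2
  have gcomp : ∀ i j, connectedComponentIn O (g i) = connectedComponentIn O (g j) → i = j := by
    intro i j hij
    obtain ⟨B, hB, hBe⟩ := Finset.mem_image.1 ((F.image e).orderEmbOfFin_mem hG i)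
    obtain ⟨B', hB', hBe'⟩ := Finset.mem_image.1 ((F.image e).orderEmbOfFin_mem hG j)
    rw [← hg] at hBe hBe'
    apply g.injective
    rw [← hBe, ← hBe'] at hij ⊢
    rw [(he B hB).2, (he B' hB').2, hij, ← (he B' hB').2]
  -- Dirichlet eigenvalues in the gaps
  have hmu : ∀ i : ℕ, ∃ m : ℝ, ∀ hi : i < n, g ⟨i, by omega⟩ < m ∧ m < g ⟨i+1, by omega⟩ ∧
      s m T = 0 ∧ m ≤ R := by
    intro i
    by_cases hi : i < n
    swap
    · exact ⟨0, fun h => absurd h hi⟩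
    set E1 := g ⟨i, by omega⟩ with hE1
    set E2 := g ⟨i+1, by omega⟩ with hE2
    have hlt : E1 < E2 := g.strictMono (by simp)
    have o1 : E1 ∈ O := (gm _).1
    have o2 : E2 ∈ O := (gm ⟨i+1, by omega⟩).1
    have : ∃ m ∈ Icc E1 E2, s m T = 0 := by
      by_contra hcon
      push Not at hcon
      have hsub : Icc E1 E2 ⊆ O := by
        intro E hE
        have := h.gap hT (by rw [← hD]; exact o1) (by rw [← hD]; exact o2) hcon E hE
        rwa [← hD] at this
      have h2 : E2 ∈ connectedComponentIn O E1 :=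
        isPreconnected_Icc.subset_connectedComponentIn (left_mem_Icc.2 hlt.le) hsub
          (right_mem_Icc.2 hlt.le)
      have := gcomp _ _ (connectedComponentIn_eq h2)
      simp at this
    obtain ⟨m, hm, hm0⟩ := this
    have hmO : m ∉ O := fun hmO => h.disc hm0 (by rw [← hD]; exact hmO)
    have m2 : m < E2 := lt_of_le_of_ne hm.2 (fun h => hmO (h ▸ o2))
    refine ⟨m, fun _ => ⟨lt_of_le_of_ne hm.1 (fun h => hmO (h ▸ o1)), m2, hm0, ?_⟩⟩
    by_contra hR
    push Not at hR
    obtain ⟨p, hp, hpR⟩ := (gm ⟨i+1, by omega⟩).2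
    obtain ⟨q, hq1, hq2⟩ := mem_closure_iff.1 hp (Iio m) isOpen_Iio (lt_of_le_of_lt hpR.2 hR)
    have hoc : (connectedComponentIn O E2).OrdConnected :=
      isPreconnected_connectedComponentIn.ordConnected
    exact hmO (connectedComponentIn_subset O E2
      (hoc.out hq2 (mem_connectedComponentIn o2) ⟨le_of_lt hq1, m2.le⟩))
  choose μ hμ using hmu
  rcases n with _ | n
  · simp only [Nat.cast_zero]
    have := Real.pi_pos
    positivity
  · have := h.count hT μ n
      (fun i hi => (hμ i (by omega)).2.1.trans (hμ (i+1) (by omega)).1)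
      (fun i hi => (hμ i (by omega)).2.2.1) (R + M)
      (fun x => by linarith [(hμ n (by omega)).2.2.2, neg_abs_le (V x), hM x])
    push_cast
    exact this

/-- If `V` is continuous and `T`-periodic with discriminant
`D(E) = tr A_E^V(T,0)`, then for each `R > 0`, at most `(T/π)·√(R + ‖V‖_∞) + 1` bands of
`σ(H_V)` (closures of connected components of `{E : D(E) ∈ (-2,2)}`) intersect `[-R, R]`. -/
theorem band_count_in_energy_window (V : ℝ → ℝ) (T : ℝ) (hV : Continuous V) (hT : 0 < T)
    (hper : Function.Periodic V T)
    (A : ℝ → Matrix (Fin 2) (Fin 2) ℝ) (hA : ∀ E : ℝ, IsTransferMatrix V E T 0 (A E))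
    (R : ℝ) (hR : 0 < R) :
    {B : Set ℝ | (∃ E ∈ {E : ℝ | (A E).trace ∈ Set.Ioo (-2 : ℝ) 2},
        B = closure (connectedComponentIn {E : ℝ | (A E).trace ∈ Set.Ioo (-2 : ℝ) 2} E)) ∧
      (B ∩ Set.Icc (-R) R).Nonempty}.Finite ∧
    ({B : Set ℝ | (∃ E ∈ {E : ℝ | (A E).trace ∈ Set.Ioo (-2 : ℝ) 2},
        B = closure (connectedComponentIn {E : ℝ | (A E).trace ∈ Set.Ioo (-2 : ℝ) 2} E)) ∧
      (B ∩ Set.Icc (-R) R).Nonempty}.ncard : ℝ)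
        ≤ T / Real.pi * Real.sqrt (R + ⨆ x : ℝ, |V x|) + 1 := by
  obtain ⟨c, c', cc, cc', c0, c0', dc, dc'⟩ := schrodSol V hV 1 0
  obtain ⟨s, s', cs, cs', s0, s0', ds, ds'⟩ := schrodSol V hV 0 1
  have h : FundSys V c c' s s' := ⟨cc, cs, cc', cs', c0, c0', s0, s0', dc, dc', ds, ds'⟩
  have hsm : ∀ (y z : ℝ → ℝ) (E : ℝ), (∀ x, HasDerivAt y (z x) x) →
      (∀ x, HasDerivAt z ((V x - E) * y x) x) →
      (A E).mulVec ![z 0, y 0] = ![z T, y T] := by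
    intro y z E hy hz
    have e1 : deriv y = z := funext fun x => (hy x).deriv
    have e2 : deriv z = fun x => (V x - E) * y x := funext fun x => (hz x).deriv
    have yc : Continuous y := continuous_iff_continuousAt.2 fun x => (hy x).continuousAt
    have hsm : ContDiff ℝ 2 y := by
      have h1 : ContDiff ℝ 1 z := by
        rw [contDiff_one_iff_deriv, e2]
        exact ⟨fun x => (hz x).differentiableAt, by fun_prop⟩
      rw [show (2 : WithTop ℕ∞) = 1 + 1 by norm_num, contDiff_succ_iff_deriv, e1]
      exact ⟨fun x => (hy x).differentiableAt, by simp, h1⟩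
    have := (hA E).2 y hsm (fun x => by rw [e1, e2]; ring)
    rwa [e1] at this
  have hD : ∀ E, (A E).trace = c E T + s' E T := by
    intro E
    have h1 := hsm (c E) (c' E) E (dc E) (dc' E)
    have h2 := hsm (s E) (s' E) E (ds E) (ds' E)
    rw [c0, c0'] at h1
    rw [s0, s0'] at h2
    have h3 := congrFun h1 1
    have h4 := congrFun h2 0
    simp [Matrix.mulVec, dotProduct, Fin.sum_univ_two] at h3 h4
    rw [Matrix.trace_fin_two, h3, h4, add_comm]
  have hM : ∀ x, |V x| ≤ ⨆ x : ℝ, |V x| := by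
    intro x
    refine le_ciSup (f := fun x => |V x|) ?_ x
    have hp : Function.Periodic (fun x => |V x|) T := fun x => by simp only [hper x]
    exact (hp.compact_of_continuous hT.ne' hV.abs).bddAbove
  have key := band_key V T hT h (fun E => (A E).trace) hD R _ hM
  set S := {B : Set ℝ | (∃ E ∈ {E : ℝ | (A E).trace ∈ Set.Ioo (-2 : ℝ) 2},
        B = closure (connectedComponentIn {E : ℝ | (A E).trace ∈ Set.Ioo (-2 : ℝ) 2} E)) ∧
      (B ∩ Set.Icc (-R) R).Nonempty} with hS
  have hfin : S.Finite := by
    by_contra hinf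
    obtain ⟨n, hn⟩ := exists_nat_gt (T / Real.pi * Real.sqrt (R + ⨆ x : ℝ, |V x|))
    obtain ⟨F, hF, hc⟩ := Set.Infinite.exists_subset_card_eq hinf (n + 1)
    exact absurd (key n F hc (fun B hB => hF hB)) (not_le.2 hn)
  refine ⟨hfin, ?_⟩
  rw [Set.ncard_eq_toFinset_card S hfin]
  rcases hn : hfin.toFinset.card with _ | n
  · have := Real.pi_pos
    simp only [Nat.cast_zero]
    positivity
  · have := key n hfin.toFinset hn (fun B hB => hfin.mem_toFinset.1 hB)
    push_cast
    linarith
end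
end
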